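/- There is a bijection between the set M*(λ,μ,ν) of 3-dimensional binary ({0,1}-entry) matrices with 1-marginals λ, μ, ν and the disjoint union over pairs of partitions (α,β) with α ⊵ λ, β ⊵ μ of the sets SSYT(α,λ) × SSYT(β,μ) × LR*(α,β;ν), where LR*(α,β;ν) is the set of pairs of Littlewood-Richardson multitableaux of shapes α, β, type ν, with termwise conjugate contents. -/

import Mathlib

open Finset Equiv
open scoped Classical

noncomputable section

/-- Value at `g` of the permutation character of `S_n` induced from the trivial character of
the Young subgroup of the composition `c`: the number of colorings of `Fin n` with fiber
sizes given by `c` that are fixed by `g`. -/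
def permChar (n : ℕ) (c : ℕ → ℕ) (g : Perm (Fin n)) : ℚ :=
  Nat.card {f : Fin n → ℕ // (∀ k, Nat.card {x : Fin n // f x = k} = c k) ∧ ∀ x, f (g x) = f x}

/-- Inner product of class functions (real-valued characters) of `S_n`. -/
def innerChar (n : ℕ) (χ ψ : Perm (Fin n) → ℚ) : ℚ :=
  (∑ g : Perm (Fin n), χ g * ψ g) / (n.factorial : ℚ)

/-- The trivial character `χ^{(n)}` of `S_n`. -/
def trivChar (n : ℕ) : Perm (Fin n) → ℚ := fun _ => 1

/-- The sign character `χ^{(1^n)}` of `S_n`. -/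
def signChar (n : ℕ) : Perm (Fin n) → ℚ := fun g => ((Perm.sign g : ℤ) : ℚ)

/-- Permutation character for an integer vector: zero if some entry is negative. -/
def permCharZ (n : ℕ) (c : ℕ → ℤ) (g : Perm (Fin n)) : ℚ :=
  if ∀ k, 0 ≤ c k then permChar n (fun k => (c k).toNat) g else 0

/-- The irreducible character `χ^a` of `S_n` indexed by the partition `a`, given by the
Jacobi–Trudi determinantal formula `χ^a = ∑_σ sgn(σ) φ^{(a_i - i + σ(i))_i}`. -/
def irrChar (n : ℕ) (a : ℕ → ℕ) (g : Perm (Fin n)) : ℚ :=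
  ∑ σ : Perm (Fin n), ((Perm.sign σ : ℤ) : ℚ) *
    permCharZ n (fun i => if h : i < n then (a i : ℤ) - i + ((σ ⟨i, h⟩ : Fin n) : ℕ) else 0) g

/-- Kronecker coefficient `k(a,b,c) = ⟨χ^a ⊗ χ^b, χ^c⟩`. -/
def kron (n : ℕ) (a b c : ℕ → ℕ) : ℚ :=
  innerChar n (fun g => irrChar n a g * irrChar n b g) (irrChar n c)

/-- Extend a vector indexed by `Fin p` to `ℕ` by zeros. -/
def extc {p : ℕ} (l : Fin p → ℕ) : ℕ → ℕ := fun i => if h : i < p then l ⟨i, h⟩ else 0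

/-- Dominance order: `a ⊵ b`. -/
def Dominates (a b : ℕ → ℕ) : Prop :=
  ∀ k, ∑ i ∈ Finset.range k, b i ≤ ∑ i ∈ Finset.range k, a i

/-- Conjugate (transpose) of a partition with at most `n` parts. -/
def conjFun (n : ℕ) (a : ℕ → ℕ) : ℕ → ℕ :=
  fun j => ((Finset.range n).filter (fun i => j < a i)).card

/-- `a` is a partition of `n` (weakly decreasing, supported on the first `n` parts). -/
def IsPartitionFun (n : ℕ) (a : ℕ → ℕ) : Prop :=
  (∀ i j, i ≤ j → a j ≤ a i) ∧ (∀ i, n ≤ i → a i = 0) ∧ ∑ i ∈ Finset.range n, a i = n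

/-- The weakly decreasing sequence of parts of `P : Nat.Partition n`. -/
def pf {n : ℕ} (P : n.Partition) : ℕ → ℕ :=
  fun i => ((P.parts.sort (· ≤ ·)).reverse).getD i 0

/-- The parts of `P : Nat.Partition n` as a vector of length `n`. -/
def pfin {n : ℕ} (P : n.Partition) : Fin n → ℕ := fun k => pf P k

/-- Number of cells of the skew shape `a/b` where the filling `T` has entry `k`. -/
def skewContent (a b : ℕ → ℕ) (T : ℕ → ℕ → ℕ) (k : ℕ) : ℕ :=
  Nat.card {p : ℕ × ℕ // b p.1 ≤ p.2 ∧ p.2 < a p.1 ∧ T p.1 p.2 = k}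

/-- Number of cells of the skew shape `a/b`. -/
def skewSize (a b : ℕ → ℕ) : ℕ :=
  Nat.card {p : ℕ × ℕ // b p.1 ≤ p.2 ∧ p.2 < a p.1}

/-- `T` is a semistandard filling of the shape `a` (zero outside, rows weakly increasing,
columns strictly increasing). -/
def IsSSYT (a : ℕ → ℕ) (T : ℕ → ℕ → ℕ) : Prop :=
  (∀ i j, a i ≤ j → T i j = 0) ∧
  (∀ i j₁ j₂, j₁ ≤ j₂ → j₂ < a i → T i j₁ ≤ T i j₂) ∧
  (∀ i₁ i₂ j, i₁ < i₂ → j < a i₂ → T i₁ j < T i₂ j)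

/-- The Kostka number: the number of semistandard Young tableaux of shape `a`
and content `c`. -/
def kostka (a c : ℕ → ℕ) : ℕ :=
  Nat.card {T : ℕ → ℕ → ℕ // IsSSYT a T ∧ ∀ k, skewContent a (fun _ => 0) T k = c k}

/-- Number of entries equal to `k` in the prefix of the (right-to-left, top-to-bottom)
reading word of `T` ending at position `(i,j)`. -/
def lrCount (a b : ℕ → ℕ) (T : ℕ → ℕ → ℕ) (i j k : ℕ) : ℕ :=
  Nat.card {p : ℕ × ℕ //
    (p.1 < i ∨ (p.1 = i ∧ j ≤ p.2)) ∧ b p.1 ≤ p.2 ∧ p.2 < a p.1 ∧ T p.1 p.2 = k}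

/-- `T` is a Littlewood–Richardson skew tableau of shape `a/b`: semistandard and its
reverse reading word is a lattice word. -/
def IsLR (a b : ℕ → ℕ) (T : ℕ → ℕ → ℕ) : Prop :=
  (∀ i j, ¬(b i ≤ j ∧ j < a i) → T i j = 0) ∧
  (∀ i j₁ j₂, b i ≤ j₁ → j₁ ≤ j₂ → j₂ < a i → T i j₁ ≤ T i j₂) ∧
  (∀ i₁ i₂ j, i₁ < i₂ → b i₁ ≤ j → j < a i₁ → b i₂ ≤ j → j < a i₂ → T i₁ j < T i₂ j) ∧
  (∀ i j k, lrCount a b T i j (k + 1) ≤ lrCount a b T i j k)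

/-- A Littlewood–Richardson multitableau of shape `α` with `r` parts: a chain of
partitions `0 = α(0) ⊆ α(1) ⊆ ⋯ ⊆ α(r) = α` together with Littlewood–Richardson
fillings of the successive skew shapes. -/
structure LRMultiF (r : ℕ) (α : ℕ → ℕ) where
  chain : Fin (r + 1) → ℕ → ℕ
  antitone : ∀ k i j, i ≤ j → chain k j ≤ chain k i
  zero : ∀ i, chain 0 i = 0
  last : ∀ i, chain (Fin.last r) i = α i
  mono : ∀ (k : Fin r) (i : ℕ), chain k.castSucc i ≤ chain k.succ i
  T : Fin r → ℕ → ℕ → ℕ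
  lr : ∀ k : Fin r, IsLR (chain k.succ) (chain k.castSucc) (T k)

/-- Content of the `k`-th tableau of a Littlewood–Richardson multitableau. -/
def LRMultiF.cont {r : ℕ} {α : ℕ → ℕ} (M : LRMultiF r α) (k : Fin r) : ℕ → ℕ :=
  skewContent (M.chain k.succ) (M.chain k.castSucc) (M.T k)

/-- Size of the `k`-th tableau of a Littlewood–Richardson multitableau. -/
def LRMultiF.size {r : ℕ} {α : ℕ → ℕ} (M : LRMultiF r α) (k : Fin r) : ℕ :=
  skewSize (M.chain k.succ) (M.chain k.castSucc)

/-- `LR(α,β;ν)`: pairs of Littlewood–Richardson multitableaux of shapes `α`, `β`,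
type `ν`, with equal contents. -/
def LRPairs (r : ℕ) (α β : ℕ → ℕ) (ν : Fin r → ℕ) :=
  {TS : LRMultiF r α × LRMultiF r β //
    (∀ k, TS.1.size k = ν k) ∧ (∀ k, TS.2.size k = ν k) ∧ ∀ k, TS.1.cont k = TS.2.cont k}

/-- `LR*(α,β;ν)`: pairs of Littlewood–Richardson multitableaux of shapes `α`, `β`,
type `ν`, with termwise conjugate contents. -/
def LRPairsStar (n r : ℕ) (α β : ℕ → ℕ) (ν : Fin r → ℕ) :=
  {TS : LRMultiF r α × LRMultiF r β //
    (∀ k, TS.1.size k = ν k) ∧ (∀ k, TS.2.size k = ν k) ∧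
      ∀ k m, TS.2.cont k m = conjFun n (TS.1.cont k) m}

/-- `lr(α,β;ν)`. -/
def lrNum (r : ℕ) (α β : ℕ → ℕ) (ν : Fin r → ℕ) : ℕ := Nat.card (LRPairs r α β ν)

/-- `lr*(α,β;ν)`. -/
def lrStarNum (n r : ℕ) (α β : ℕ → ℕ) (ν : Fin r → ℕ) : ℕ :=
  Nat.card (LRPairsStar n r α β ν)

/-- A semistandard Young tableau (of arbitrary partition shape). -/
structure SSYTP where
  shape : ℕ → ℕ
  T : ℕ → ℕ → ℕ
  antitone : ∀ i j, i ≤ j → shape j ≤ shape i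
  finite : ∃ N, ∀ i, N ≤ i → shape i = 0
  ssyt : IsSSYT shape T

/-- Content of a semistandard Young tableau. -/
def SSYTP.cont (P : SSYTP) : ℕ → ℕ := skewContent P.shape (fun _ => 0) P.T

/-- The multiset of entries of a matrix. -/
def entriesM {p q : ℕ} (A : Fin p → Fin q → ℕ) : Multiset ℕ :=
  (Finset.univ : Finset (Fin p × Fin q)).val.map (fun ij => A ij.1 ij.2)

/-- The π-sequence of `A` is the partition `ν` (the weakly decreasing rearrangement of
the entries of `A` is `ν`). -/
def HasPiSeq {p q : ℕ} (A : Fin p → Fin q → ℕ) {n : ℕ} (ν : n.Partition) : Prop :=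
  (entriesM A).filter (· ≠ 0) = ν.parts

end

noncomputable section

/-- Gelfand–Tsetlin patterns with `p` levels and top row `a`: the levels `g 0, g 1, …` form a
chain of horizontal strips from the empty partition to `a`, constant from level `p` on. -/
structure IsGT (p : ℕ) (a : ℕ → ℕ) (g : ℕ → ℕ → ℕ) : Prop where
  zero : ∀ i, g 0 i = 0
  top : ∀ k i, p ≤ k → g k i = a i
  mono : ∀ k i, g k i ≤ g (k + 1) i
  inter : ∀ k i, g (k + 1) (i + 1) ≤ g k i

/-- Sum of the first `i` entries of level `k`. -/
def gtSum (g : ℕ → ℕ → ℕ) (k i : ℕ) : ℕ := ∑ j ∈ range i, g k j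

/-- The weight of a pattern: the differences of the sums of consecutive levels. -/
def gtWeight (p : ℕ) (g : ℕ → ℕ → ℕ) (k : ℕ) : ℕ := gtSum g (k + 1) p - gtSum g k p

/-- Smallest value of the entry `(k+1, i)` allowed by levels `k` and `k+2`. -/
def gtLow (g : ℕ → ℕ → ℕ) (k i : ℕ) : ℕ := max (g k i) (g (k + 2) (i + 1))

/-- Largest value of the entry `(k+1, i)` allowed by levels `k` and `k+2`. -/
def gtUp (g : ℕ → ℕ → ℕ) (k : ℕ) : ℕ → ℕ
  | 0 => g (k + 2) 0
  | i + 1 => min (g (k + 2) (i + 1)) (g k i)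

/-- The truncated Bender–Knuth involution: reflect the entries `(k+1, i')`, `i ≤ i'`, in their
allowed intervals, where the interval for `i' = i` is cut off at `x`. -/
def gtFlip (k i x : ℕ) (g : ℕ → ℕ → ℕ) : ℕ → ℕ → ℕ := fun k' i' =>
  if k' = k + 1 ∧ i ≤ i' then
    gtLow g k i' + (if i' = i then x else gtUp g k i') - g (k + 1) i'
  else g k' i'

theorem gtSum_succ (g : ℕ → ℕ → ℕ) (k i : ℕ) : gtSum g k (i + 1) = gtSum g k i + g k i :=
  sum_range_succ _ _

theorem gtSum_zero (g : ℕ → ℕ → ℕ) (k : ℕ) : gtSum g k 0 = 0 := rfl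

theorem gtSum_congr {g h : ℕ → ℕ → ℕ} {k i : ℕ} (H : ∀ j < i, g k j = h k j) :
    gtSum g k i = gtSum h k i :=
  sum_congr rfl fun j hj => H j (mem_range.1 hj)

namespace IsGT

variable {p : ℕ} {a : ℕ → ℕ} {g : ℕ → ℕ → ℕ}

theorem eq_zero (h : IsGT p a g) : ∀ {k i : ℕ}, k ≤ i → g k i = 0
  | 0, i, _ => h.zero i
  | k + 1, 0, hk => by omega
  | k + 1, i + 1, hk => by
    have h1 := h.inter k i
    have h2 := h.eq_zero (k := k) (i := i) (by omega)
    omega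

theorem mono_le (h : IsGT p a g) {k l : ℕ} (hkl : k ≤ l) (i : ℕ) : g k i ≤ g l i :=
  monotone_nat_of_le_succ (fun k => h.mono k i) hkl

theorem le_top (h : IsGT p a g) (k i : ℕ) : g k i ≤ a i := by
  rw [← h.top (max k p) i (le_max_right _ _)]
  exact h.mono_le (le_max_left _ _) i

theorem level_antitone (h : IsGT p a g) (k : ℕ) : Antitone (g k) :=
  antitone_nat_of_succ_le fun i => (h.mono k (i + 1)).trans (h.inter k i)

theorem antitone (h : IsGT p a g) : Antitone a := by
  have : a = g p := funext fun i => (h.top p i le_rfl).symm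
  rw [this]
  exact h.level_antitone p

theorem top_eq_zero (h : IsGT p a g) {i : ℕ} (hi : p ≤ i) : a i = 0 := by
  rw [← h.top p i le_rfl]
  exact h.eq_zero hi

theorem gtSum_mono (h : IsGT p a g) (k i : ℕ) : gtSum g k i ≤ gtSum g (k + 1) i :=
  sum_le_sum fun j _ => h.mono k j

theorem gtSum_zero_level (h : IsGT p a g) (i : ℕ) : gtSum g 0 i = 0 :=
  sum_eq_zero fun j _ => h.zero j

theorem gtSum_stable (h : IsGT p a g) {k i j : ℕ} (hi : k ≤ i) (hij : i ≤ j) :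
    gtSum g k j = gtSum g k i := by
  induction j, hij using Nat.le_induction with
  | base => rfl
  | succ j hj ih => rw [gtSum_succ, ih, h.eq_zero (hi.trans hj), add_zero]

theorem weight_add (h : IsGT p a g) (k : ℕ) :
    gtSum g k p + gtWeight p g k = gtSum g (k + 1) p := by
  have := h.gtSum_mono k p
  unfold gtWeight
  omega

theorem low_le (h : IsGT p a g) (k i : ℕ) : gtLow g k i ≤ g (k + 1) i :=
  max_le (h.mono k i) (h.inter (k + 1) i)

theorem le_up (h : IsGT p a g) (k i : ℕ) : g (k + 1) i ≤ gtUp g k i := by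
  cases i with
  | zero => exact h.mono _ _
  | succ i => exact le_min (h.mono _ _) (h.inter _ _)

end IsGT

section Flip

variable {p : ℕ} {a : ℕ → ℕ} {g : ℕ → ℕ → ℕ} {k i x : ℕ}

theorem gtFlip_of_ne {k' : ℕ} (hk : k' ≠ k + 1) : gtFlip k i x g k' = g k' := by
  funext i'
  simp [gtFlip, hk]

theorem gtFlip_of_lt {k' i' : ℕ} (hi : i' < i) : gtFlip k i x g k' i' = g k' i' := by
  simp [gtFlip, hi]

theorem gtFlip_self : gtFlip k i x g (k + 1) i = gtLow g k i + x - g (k + 1) i := by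
  simp [gtFlip]

theorem gtFlip_of_gt {i' : ℕ} (hi : i < i') :
    gtFlip k i x g (k + 1) i' = gtLow g k i' + gtUp g k i' - g (k + 1) i' := by
  simp [gtFlip, hi.le, hi.ne']

theorem gtLow_gtFlip (i' : ℕ) : gtLow (gtFlip k i x g) k i' = gtLow g k i' := by
  simp [gtLow, gtFlip_of_ne]

theorem gtUp_gtFlip (i' : ℕ) : gtUp (gtFlip k i x g) k i' = gtUp g k i' := by
  cases i' <;> simp [gtUp, gtFlip_of_ne]

theorem gtFlip_mem (h : IsGT p a g) (hg : g (k + 1) i ≤ x) (hx : x ≤ gtUp g k i) (i' : ℕ) :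
    gtLow g k i' ≤ gtFlip k i x g (k + 1) i' ∧ gtFlip k i x g (k + 1) i' ≤ gtUp g k i' := by
  have h1 := h.low_le k i'
  have h2 := h.le_up k i'
  rcases lt_trichotomy i' i with hi | rfl | hi
  · rw [gtFlip_of_lt hi]; exact ⟨h1, h2⟩
  · rw [gtFlip_self]; omega
  · rw [gtFlip_of_gt hi]; omega

theorem isGT_gtFlip (h : IsGT p a g) (hk : k + 1 < p) (hg : g (k + 1) i ≤ x)
    (hx : x ≤ gtUp g k i) : IsGT p a (gtFlip k i x g) := by
  have key := gtFlip_mem h hg hx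
  have e1 : gtFlip k i x g k = g k := gtFlip_of_ne (by omega)
  have e2 : gtFlip k i x g (k + 2) = g (k + 2) := gtFlip_of_ne (by omega)
  refine ⟨fun j => ?_, fun k' j hk' => ?_, fun k' j => ?_, fun k' j => ?_⟩
  · rw [gtFlip_of_ne (by omega)]; exact h.zero j
  · rw [gtFlip_of_ne (by omega)]; exact h.top k' j hk'
  · rcases eq_or_ne k' k with rfl | h1
    · rw [e1]; exact (le_max_left _ _).trans (key j).1
    rcases eq_or_ne k' (k + 1) with rfl | h2
    · rw [e2]
      refine (key j).2.trans ?_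
      cases j with
      | zero => exact le_rfl
      | succ j => exact min_le_left _ _
    · rw [gtFlip_of_ne h2, gtFlip_of_ne (by omega)]; exact h.mono k' j
  · rcases eq_or_ne k' k with rfl | h1
    · rw [e1]; exact (key (j + 1)).2.trans (min_le_right _ _)
    rcases eq_or_ne k' (k + 1) with rfl | h2
    · rw [e2]; exact (le_max_right _ _).trans (key j).1
    · rw [gtFlip_of_ne h2, gtFlip_of_ne (by omega)]; exact h.inter k' j

theorem gtFlip_gtFlip (h : IsGT p a g) (hg : g (k + 1) i ≤ x) (hx : x ≤ gtUp g k i) :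
    gtFlip k i x (gtFlip k i x g) = g := by
  funext k' i'
  rcases eq_or_ne k' (k + 1) with rfl | hk'
  · have h1 := h.low_le k i'
    have h2 := h.le_up k i'
    rcases lt_trichotomy i' i with hi | rfl | hi
    · rw [gtFlip_of_lt hi, gtFlip_of_lt hi]
    · rw [gtFlip_self, gtFlip_self, gtLow_gtFlip]; omega
    · rw [gtFlip_of_gt hi, gtFlip_of_gt hi, gtLow_gtFlip, gtUp_gtFlip]; omega
  · rw [gtFlip_of_ne hk', gtFlip_of_ne hk']

theorem gtSum_gtFlip_aux (h : IsGT p a g) (hg : g (k + 1) i ≤ x)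
    {P : ℕ} (hP : i + 1 ≤ P) :
    gtSum (gtFlip k i x g) (k + 1) P + gtSum g (k + 1) P + gtUp g k P + gtSum g k i
        + gtSum g (k + 2) (i + 1)
      = 2 * gtSum g (k + 1) i + gtSum g k P + gtSum g (k + 2) (P + 1) + x := by
  have hsum : ∀ j, gtLow g k j + gtUp g k (j + 1) = g k j + g (k + 2) (j + 1) := by
    intro j
    simp only [gtLow, gtUp]
    omega
  induction P, hP using Nat.le_induction with
  | base =>
    have h1 := h.low_le k i
    have h3 := hsum i
    have h4 : gtSum (gtFlip k i x g) (k + 1) i = gtSum g (k + 1) i :=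
      gtSum_congr fun j hj => gtFlip_of_lt hj
    rw [gtSum_succ, gtSum_succ g (k + 1), gtSum_succ g k, gtSum_succ g (k + 2) (i + 1),
      gtFlip_self, h4]
    omega
  | succ P hP ih =>
    have h1 := h.low_le k P
    have h2 := h.le_up k P
    have h3 := hsum P
    rw [gtSum_succ, gtSum_succ g (k + 1), gtSum_succ g k, gtSum_succ g (k + 2) (P + 1),
      gtFlip_of_gt (by omega)]
    omega

theorem gtSum_gtFlip (h : IsGT p a g) (hk : k + 1 < p) (hi : i < p) (hg : g (k + 1) i ≤ x) :
    gtSum (gtFlip k i x g) (k + 1) p + gtSum g (k + 1) p + gtSum g k i + gtSum g (k + 2) (i + 1)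
      = 2 * gtSum g (k + 1) i + gtSum g k p + gtSum g (k + 2) p + x := by
  have h1 := gtSum_gtFlip_aux h hg (P := p) hi
  have h2 : g (k + 2) p = 0 := h.eq_zero (by omega)
  have h3 : gtUp g k p = 0 := by
    obtain ⟨q, rfl⟩ : ∃ q, p = q + 1 := ⟨p - 1, by omega⟩
    simp [gtUp, h2]
  rw [gtSum_succ g (k + 2) p] at h1
  omega

end Flip

/-- Adding `gtWeight p g` step by step to `lam`, reading row `i` of the corresponding tableau,
fails to be dominant at the pair `(k, k+1)`. -/
def GTViol (lam : ℕ → ℕ) (g : ℕ → ℕ → ℕ) (k i : ℕ) : Prop :=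
  lam k + gtSum g (k + 1) (i + 1) + gtSum g (k + 1) i
    < lam (k + 1) + gtSum g (k + 2) (i + 1) + gtSum g k i

/-- `lam`-dominance of a pattern. -/
def GTGood (p : ℕ) (lam : ℕ → ℕ) (g : ℕ → ℕ → ℕ) : Prop :=
  ∀ k i, k + 1 < p → ¬ GTViol lam g k i

/-- `(k, i)` is the position of the first violation, in reading order. -/
def GTFirst (p : ℕ) (lam : ℕ → ℕ) (g : ℕ → ℕ → ℕ) (k i : ℕ) : Prop :=
  k + 1 < p ∧ GTViol lam g k i ∧ (∀ k' i', i' < i → k' + 1 < p → ¬ GTViol lam g k' i') ∧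
    ∀ k', k < k' → k' + 1 < p → ¬ GTViol lam g k' i

/-- The place in row `i` where the violation occurs. -/
def gtThreshold (lam : ℕ → ℕ) (g : ℕ → ℕ → ℕ) (k i : ℕ) : ℕ :=
  lam (k + 1) + gtSum g k i + gtSum g (k + 2) (i + 1) - (lam k + 2 * gtSum g (k + 1) i + 1)

theorem GTFirst.unique {p : ℕ} {lam : ℕ → ℕ} {g : ℕ → ℕ → ℕ} {k i k' i' : ℕ}
    (h : GTFirst p lam g k i) (h' : GTFirst p lam g k' i') : k = k' ∧ i = i' := by
  obtain rfl : i = i' := by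
    rcases lt_trichotomy i i' with hi | hi | hi
    · exact absurd h.2.1 (h'.2.2.1 k i hi h.1)
    · exact hi
    · exact absurd h'.2.1 (h.2.2.1 k' i' hi h'.1)
  refine ⟨?_, rfl⟩
  rcases lt_trichotomy k k' with hk | hk | hk
  · exact absurd h'.2.1 (h.2.2.2 k' hk h'.1)
  · exact hk
  · exact absurd h.2.1 (h'.2.2.2 k hk h.1)

theorem exists_gtFirst {p : ℕ} {lam : ℕ → ℕ} {g : ℕ → ℕ → ℕ} (h : ¬ GTGood p lam g) :
    ∃ ki : ℕ × ℕ, GTFirst p lam g ki.1 ki.2 := by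
  have hex : ∃ i, ∃ k, k + 1 < p ∧ GTViol lam g k i := by
    unfold GTGood at h
    push Not at h
    obtain ⟨k, i, h1, h2⟩ := h
    exact ⟨i, k, h1, h2⟩
  set i := Nat.find hex
  obtain ⟨k₀, hk₀⟩ := Nat.find_spec hex
  set k := Nat.findGreatest (fun k => k + 1 < p ∧ GTViol lam g k i) p
  have hk : k + 1 < p ∧ GTViol lam g k i :=
    Nat.findGreatest_spec (P := fun k => k + 1 < p ∧ GTViol lam g k i) (m := k₀)
      (by omega) hk₀
  refine ⟨(k, i), hk.1, hk.2, fun k' i' hi' hk' hv => ?_, fun k' hkk' hk' hv => ?_⟩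
  · exact Nat.find_min hex hi' ⟨k', hk', hv⟩
  · exact Nat.findGreatest_is_greatest (P := fun k => k + 1 < p ∧ GTViol lam g k i) hkk'
      (by omega) ⟨hk', hv⟩

section Threshold

variable {p : ℕ} {a lam : ℕ → ℕ} {g : ℕ → ℕ → ℕ} {k i : ℕ}

theorem GTFirst.threshold_add (hf : GTFirst p lam g k i) :
    gtThreshold lam g k i + (lam k + 2 * gtSum g (k + 1) i + 1)
      = lam (k + 1) + gtSum g k i + gtSum g (k + 2) (i + 1) := by
  have := hf.2.1
  unfold GTViol at this
  rw [gtSum_succ g (k + 1)] at this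
  unfold gtThreshold
  omega

theorem GTFirst.le_threshold (hf : GTFirst p lam g k i) :
    g (k + 1) i ≤ gtThreshold lam g k i := by
  have h1 := hf.threshold_add
  have := hf.2.1
  unfold GTViol at this
  rw [gtSum_succ g (k + 1)] at this
  omega

theorem GTFirst.threshold_le (hlam : Antitone lam) (h : IsGT p a g) (hf : GTFirst p lam g k i) :
    gtThreshold lam g k i ≤ gtUp g k i := by
  have h1 := hf.threshold_add
  have h2 : lam (k + 1) ≤ lam k := hlam (Nat.le_succ k)
  rw [gtSum_succ g (k + 2)] at h1
  cases i with
  | zero =>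
    simp only [gtSum_zero] at h1
    simp only [gtUp]
    omega
  | succ i =>
    have h3 := hf.2.2.1 k i (Nat.lt_succ_self i) hf.1
    unfold GTViol at h3
    have h4 := h.mono k i
    have h5 : g (k + 2) (i + 1) ≤ g (k + 1) i := h.inter (k + 1) i
    rw [gtSum_succ] at h1 h3
    rw [gtSum_succ g k] at h1
    rw [gtSum_succ g (k + 2)] at h1 h3
    refine le_min ?_ ?_ <;> omega

theorem GTFirst.lt_top (h : IsGT p a g) (hf : GTFirst p lam g k i) : i < p := by
  by_contra hi
  have hk := hf.1
  obtain ⟨j, rfl⟩ : ∃ j, i = j + 1 := ⟨i - 1, by omega⟩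
  apply hf.2.2.1 k j (Nat.lt_succ_self j) hk
  have hv := hf.2.1
  unfold GTViol at hv ⊢
  rw [gtSum_succ g _ (j + 1), gtSum_succ g _ (j + 1), h.eq_zero (k := k + 1) (by omega),
    h.eq_zero (k := k + 2) (by omega), gtSum_succ g k, h.eq_zero (k := k) (by omega)] at hv
  rw [← h.gtSum_stable (k := k + 1) (i := j) (j := j + 1) (by omega) (by omega)]
  omega

theorem GTFirst.flip (h : IsGT p a g) (hf : GTFirst p lam g k i) :
    GTFirst p lam (gtFlip k i (gtThreshold lam g k i) g) k i ∧
      gtThreshold lam (gtFlip k i (gtThreshold lam g k i) g) k i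
        = gtThreshold lam g k i := by
  set x := gtThreshold lam g k i with hx
  have hlt : ∀ k' i', i' ≤ i → gtSum (gtFlip k i x g) k' i' = gtSum g k' i' :=
    fun k' i' hi' => gtSum_congr fun j hj => gtFlip_of_lt (by omega)
  have hne : ∀ k' i', k' ≠ k + 1 → gtSum (gtFlip k i x g) k' i' = gtSum g k' i' :=
    fun k' i' hk' => by unfold gtSum; rw [gtFlip_of_ne hk']
  refine ⟨⟨hf.1, ?_, ?_, ?_⟩, ?_⟩
  · have h1 := hf.threshold_add
    have h2 := hf.le_threshold
    have h3 := h.low_le k i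
    unfold GTViol
    rw [gtSum_succ, hlt _ _ le_rfl, hne (k + 2) _ (by omega), hlt _ _ le_rfl, gtFlip_self]
    omega
  · intro k' i' hi' hk'
    have := hf.2.2.1 k' i' hi' hk'
    unfold GTViol at this ⊢
    rwa [hlt _ _ (by omega), hlt _ _ (by omega), hlt _ _ (by omega), hlt _ _ (by omega)]
  · intro k' hkk' hk'
    have := hf.2.2.2 k' hkk' hk'
    unfold GTViol at this ⊢
    rwa [hne (k' + 1) _ (by omega), hne (k' + 1) _ (by omega), hne (k' + 2) _ (by omega),
      hlt _ _ le_rfl]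
  · unfold gtThreshold
    rw [hlt _ _ le_rfl, hlt _ _ le_rfl, hne (k + 2) _ (by omega)]
    rfl

theorem GTFirst.weight_flip (hlam : Antitone lam) (h : IsGT p a g) (hf : GTFirst p lam g k i) :
    (∀ j, j ≠ k → j ≠ k + 1 →
      gtWeight p (gtFlip k i (gtThreshold lam g k i) g) j = gtWeight p g j) ∧
    lam k + gtWeight p (gtFlip k i (gtThreshold lam g k i) g) k + 1
      = lam (k + 1) + gtWeight p g (k + 1) ∧
    lam (k + 1) + gtWeight p (gtFlip k i (gtThreshold lam g k i) g) (k + 1)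
      = lam k + gtWeight p g k + 1 := by
  have h' := isGT_gtFlip h hf.1 hf.le_threshold (hf.threshold_le hlam h)
  have h1 := gtSum_gtFlip h hf.1 (hf.lt_top h) hf.le_threshold
  have h2 := hf.threshold_add
  set x := gtThreshold lam g k i with hx
  have hne : ∀ k' i', k' ≠ k + 1 → gtSum (gtFlip k i x g) k' i' = gtSum g k' i' :=
    fun k' i' hk' => by unfold gtSum; rw [gtFlip_of_ne hk']
  have e1 := h'.weight_add k
  have e2 : _ = gtSum _ (k + 2) p := h'.weight_add (k + 1)
  have e3 := h.weight_add k
  have e4 : _ = gtSum _ (k + 2) p := h.weight_add (k + 1)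
  rw [hne k _ (by omega)] at e1
  rw [hne (k + 2) _ (by omega)] at e2
  refine ⟨fun j hj hj' => ?_, ?_, ?_⟩
  · unfold gtWeight
    rw [hne _ _ (by omega), hne _ _ (by omega)]
  · omega
  · omega

end Threshold

theorem gtWeight_flip_full {p : ℕ} {a : ℕ → ℕ} {g : ℕ → ℕ → ℕ} {k : ℕ} (h : IsGT p a g)
    (hk : k + 1 < p) :
    (∀ j, j ≠ k → j ≠ k + 1 → gtWeight p (gtFlip k 0 (g (k + 2) 0) g) j = gtWeight p g j) ∧
    gtWeight p (gtFlip k 0 (g (k + 2) 0) g) k = gtWeight p g (k + 1) ∧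
    gtWeight p (gtFlip k 0 (g (k + 2) 0) g) (k + 1) = gtWeight p g k := by
  have h' := isGT_gtFlip (x := g (k + 2) 0) h hk (h.mono (k + 1) 0) le_rfl
  have h1 := gtSum_gtFlip (i := 0) (x := g (k + 2) 0) h hk (by omega) (h.mono (k + 1) 0)
  set x := g (k + 2) 0 with hx
  have hne : ∀ k' i', k' ≠ k + 1 → gtSum (gtFlip k 0 x g) k' i' = gtSum g k' i' :=
    fun k' i' hk' => by unfold gtSum; rw [gtFlip_of_ne hk']
  have e1 := h'.weight_add k
  have e2 : _ = gtSum _ (k + 2) p := h'.weight_add (k + 1)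
  have e3 := h.weight_add k
  have e4 : _ = gtSum _ (k + 2) p := h.weight_add (k + 1)
  rw [hne k _ (by omega)] at e1
  rw [hne (k + 2) _ (by omega)] at e2
  rw [gtSum_succ] at h1
  simp only [gtSum_zero] at h1
  refine ⟨fun j hj hj' => ?_, ?_, ?_⟩
  · unfold gtWeight
    rw [hne _ _ (by omega), hne _ _ (by omega)]
  · omega
  · omega

instance finite_isGT (p : ℕ) (a : ℕ → ℕ) : Finite {g : ℕ → ℕ → ℕ // IsGT p a g} := by
  let F : {g : ℕ → ℕ → ℕ // IsGT p a g} → ((k : Fin p) → (i : Fin p) → Fin (a i + 1)) :=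
    fun g k i => ⟨g.1 k i, Nat.lt_succ_of_le (g.2.le_top k i)⟩
  refine Finite.of_injective F fun g h hgh => Subtype.ext ?_
  funext k i
  rcases le_or_gt p k with hk | hk
  · rw [g.2.top k i hk, h.2.top k i hk]
  rcases le_or_gt p i with hi | hi
  · rw [g.2.eq_zero (by omega), h.2.eq_zero (by omega)]
  · exact congrArg Fin.val (congrFun (congrFun hgh ⟨k, hk⟩) ⟨i, hi⟩)

instance fintype_isGT (p : ℕ) (a : ℕ → ℕ) : Fintype {g : ℕ → ℕ → ℕ // IsGT p a g} :=
  Fintype.ofFinite _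

/-- The Schur function of `a` in the variables `x`. -/
def schur {R : Type*} [CommRing R] {p : ℕ} (x : Fin p → R) (a : ℕ → ℕ) : R :=
  ∑ g : {g : ℕ → ℕ → ℕ // IsGT p a g}, ∏ k : Fin p, x k ^ gtWeight p g.1 k

theorem map_schur {R S : Type*} [CommRing R] [CommRing S] (f : R →+* S) {p : ℕ} (x : Fin p → R)
    (a : ℕ → ℕ) : f (schur x a) = schur (fun i => f (x i)) a := by
  simp [schur, map_sum, map_prod, map_pow]

theorem schur_eq_zero {R : Type*} [CommRing R] {p : ℕ} (x : Fin p → R) {a : ℕ → ℕ}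
    (ha : ¬ ∀ i, p ≤ i → a i = 0) : schur x a = 0 := by
  have : IsEmpty {g : ℕ → ℕ → ℕ // IsGT p a g} :=
    ⟨fun g => ha fun i hi => g.2.top_eq_zero hi⟩
  simp [schur]

theorem isGT_zero_iff {p : ℕ} {g : ℕ → ℕ → ℕ} : IsGT p (fun _ => 0) g ↔ g = fun _ _ => 0 := by
  constructor
  · intro h
    funext k i
    exact Nat.le_zero.1 (h.le_top k i)
  · rintro rfl
    constructor <;> simp

theorem schur_zero {R : Type*} [CommRing R] {p : ℕ} (x : Fin p → R) :
    schur x (fun _ => 0) = 1 := by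
  have : Unique {g : ℕ → ℕ → ℕ // IsGT p (fun _ => 0) g} :=
    { default := ⟨_, isGT_zero_iff.2 rfl⟩
      uniq := fun g => Subtype.ext (isGT_zero_iff.1 g.2) }
  unfold schur
  rw [Fintype.sum_eq_single default (fun g hg => absurd (Subsingleton.elim _ _) hg)]
  have h : (default : {g : ℕ → ℕ → ℕ // IsGT p (fun _ => 0) g}).1 = fun _ _ => 0 :=
    isGT_zero_iff.1 (default : {g : ℕ → ℕ → ℕ // IsGT p (fun _ => 0) g}).2
  simp [h, gtWeight, gtSum]

open MvPolynomial in
/-- The alternating polynomial with exponents `v`. -/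
def alternant {p : ℕ} (v : Fin p → ℕ) : MvPolynomial (Fin p) ℤ :=
  (Matrix.of fun i j => (X i : MvPolynomial (Fin p) ℤ) ^ v j).det

theorem alternant_comp {p : ℕ} (v : Fin p → ℕ) (σ : Perm (Fin p)) :
    alternant (v ∘ σ) = Perm.sign σ * alternant v :=
  Matrix.det_permute' σ (Matrix.of fun i j => (MvPolynomial.X i : MvPolynomial (Fin p) ℤ) ^ v j)

theorem alternant_eq_zero {p : ℕ} {v : Fin p → ℕ} {i j : Fin p} (hij : i ≠ j)
    (hv : v i = v j) : alternant v = 0 :=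
  Matrix.det_zero_of_column_eq hij fun k => by simp [hv]

open MvPolynomial in
theorem alternant_mul {p : ℕ} {T : Type*} [Fintype T] (v : Fin p → ℕ) (w : T → Fin p → ℕ)
    (hs : ∀ σ : Perm (Fin p), rename σ (∑ t, ∏ i, (X i : MvPolynomial (Fin p) ℤ) ^ w t i)
      = ∑ t, ∏ i, (X i : MvPolynomial (Fin p) ℤ) ^ w t i) :
    alternant v * ∑ t, ∏ i, (X i : MvPolynomial (Fin p) ℤ) ^ w t i
      = ∑ t, alternant (fun i => v i + w t i) := by
  simp only [alternant, Matrix.det_apply, Matrix.of_apply]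
  rw [sum_mul, sum_comm]
  refine sum_congr rfl fun σ _ => ?_
  rw [← hs σ, map_sum, mul_sum]
  refine sum_congr rfl fun t _ => ?_
  rw [map_prod, smul_mul_assoc, ← prod_mul_distrib]
  simp [pow_add]

open MvPolynomial in
theorem rename_eq_of_swap {p : ℕ} {s : MvPolynomial (Fin p) ℤ}
    (h : ∀ (k : ℕ) (hk : k + 1 < p), rename (swap (⟨k, by omega⟩ : Fin p) ⟨k + 1, hk⟩) s = s)
    (σ : Perm (Fin p)) : rename σ s = s := by
  cases p with
  | zero => rw [Subsingleton.elim σ 1]; simp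
  | succ n =>
    have hσ : σ ∈ Submonoid.closure (Set.range fun i : Fin n => swap i.castSucc i.succ) := by
      rw [Perm.mclosure_swap_castSucc_succ]; trivial
    induction hσ using Submonoid.closure_induction with
    | mem x hx =>
      obtain ⟨i, rfl⟩ := hx
      exact h i (by omega)
    | one => simp
    | mul x y _ _ hx hy =>
      rw [Perm.coe_mul, ← rename_rename, hy, hx]

/-- The full Bender–Knuth involution. -/
def gtFlipEquiv {p : ℕ} (a : ℕ → ℕ) {k : ℕ} (hk : k + 1 < p) :
    Perm {g : ℕ → ℕ → ℕ // IsGT p a g} :=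
  Function.Involutive.toPerm
    (fun g => ⟨gtFlip k 0 (g.1 (k + 2) 0) g.1, isGT_gtFlip g.2 hk (g.2.mono (k + 1) 0) le_rfl⟩)
    (fun g => Subtype.ext (by
      have h := gtFlip_gtFlip (x := g.1 (k + 2) 0) g.2 (g.2.mono (k + 1) 0) le_rfl
      have e : gtFlip k 0 (g.1 (k + 2) 0) g.1 (k + 2) 0 = g.1 (k + 2) 0 := by
        rw [gtFlip_of_ne (by omega)]
      simpa [e] using h))

open MvPolynomial in
theorem rename_schur {p : ℕ} (a : ℕ → ℕ) (σ : Perm (Fin p)) :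
    rename σ (schur (X : Fin p → MvPolynomial (Fin p) ℤ) a) = schur X a := by
  refine rename_eq_of_swap (fun k hk => ?_) σ
  unfold schur
  rw [map_sum, ← Equiv.sum_comp (gtFlipEquiv a hk)]
  refine sum_congr rfl fun g _ => ?_
  obtain ⟨h1, h2, h3⟩ := gtWeight_flip_full g.2 hk
  rw [map_prod, ← Equiv.prod_comp (swap (⟨k, by omega⟩ : Fin p) ⟨k + 1, hk⟩)]
  refine prod_congr rfl fun j _ => ?_
  rw [map_pow, rename_X, swap_apply_self]
  congr 1
  change gtWeight p (gtFlip k 0 (g.1 (k + 2) 0) g.1) _ = _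
  rcases eq_or_ne j ⟨k, by omega⟩ with rfl | hj
  · rw [swap_apply_left]; exact h3
  rcases eq_or_ne j ⟨k + 1, hk⟩ with rfl | hj'
  · rw [swap_apply_right]; exact h2
  · rw [swap_apply_of_ne_of_ne hj hj']
    exact h1 j (fun h => hj (Fin.ext h)) (fun h => hj' (Fin.ext h))

/-- The alternant of `lam + δ`. -/
def deltaAlt (p : ℕ) (lam : ℕ → ℕ) : MvPolynomial (Fin p) ℤ :=
  alternant fun k : Fin p => lam k + (p - 1 - k)

theorem deltaAlt_congr {p : ℕ} {lam mu : ℕ → ℕ} (h : ∀ k < p, lam k = mu k) :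
    deltaAlt p lam = deltaAlt p mu := by
  unfold deltaAlt
  congr 1
  funext k
  rw [h k k.2]

theorem deltaAlt_ne_zero (p : ℕ) : deltaAlt p (fun _ => 0) ≠ 0 := by
  have h : deltaAlt p (fun _ => 0)
      = alternant ((fun k : Fin p => (k : ℕ)) ∘ (Fin.revPerm : Perm (Fin p))) := by
    unfold deltaAlt
    congr 1
    funext k
    simp [Fin.val_rev]
    omega
  rw [h, alternant_comp]
  refine mul_ne_zero ?_ ?_
  · rcases Int.units_eq_one_or (Perm.sign (Fin.revPerm : Perm (Fin p))) with h | h <;> simp [h]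
  · exact Matrix.det_vandermonde_ne_zero_iff.2 (MvPolynomial.X_injective)

theorem deltaAlt_eq_zero {p : ℕ} {lam : ℕ → ℕ} {k : ℕ} (hk : k + 1 < p)
    (h : lam k + 1 = lam (k + 1)) : deltaAlt p lam = 0 := by
  refine alternant_eq_zero (i := ⟨k, by omega⟩) (j := ⟨k + 1, hk⟩) (by simp) ?_
  simp only
  omega

theorem deltaAlt_add_deltaAlt {p : ℕ} {lam mu : ℕ → ℕ} {k : ℕ} (hk : k + 1 < p)
    (h1 : lam k + 1 = mu (k + 1)) (h2 : lam (k + 1) = mu k + 1)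
    (h : ∀ j, j ≠ k → j ≠ k + 1 → lam j = mu j) : deltaAlt p lam + deltaAlt p mu = 0 := by
  have hne : (⟨k, by omega⟩ : Fin p) ≠ ⟨k + 1, hk⟩ := by simp
  have : deltaAlt p lam = alternant ((fun j : Fin p => mu j + (p - 1 - j)) ∘
      swap (⟨k, by omega⟩ : Fin p) ⟨k + 1, hk⟩) := by
    unfold deltaAlt
    congr 1
    funext j
    simp only [Function.comp]
    rcases eq_or_ne j ⟨k, by omega⟩ with rfl | hj
    · rw [swap_apply_left]; simp only; omega
    rcases eq_or_ne j ⟨k + 1, hk⟩ with rfl | hj'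
    · rw [swap_apply_right]; simp only; omega
    · rw [swap_apply_of_ne_of_ne hj hj', h j (fun h => hj (Fin.ext h)) (fun h => hj' (Fin.ext h))]
  rw [this, alternant_comp, Perm.sign_swap hne]
  simp [deltaAlt]

theorem deltaAlt_mul_schur {p : ℕ} {lam : ℕ → ℕ} (hlam : Antitone lam) (a : ℕ → ℕ) :
    deltaAlt p lam * schur MvPolynomial.X a
      = ∑ g : {g : ℕ → ℕ → ℕ // IsGT p a g} with GTGood p lam g.1,
          deltaAlt p (fun k => lam k + gtWeight p g.1 k) := by
  have h0 : deltaAlt p lam * schur MvPolynomial.X a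
      = ∑ g : {g : ℕ → ℕ → ℕ // IsGT p a g}, deltaAlt p (fun k => lam k + gtWeight p g.1 k) := by
    unfold deltaAlt schur
    rw [alternant_mul _ _ fun σ => rename_schur a σ]
    refine sum_congr rfl fun g _ => ?_
    congr 1
    funext k
    exact Nat.add_right_comm _ _ _
  rw [h0, ← sum_filter_add_sum_filter_not univ
    (fun g : {g : ℕ → ℕ → ℕ // IsGT p a g} => GTGood p lam g.1), add_eq_left]
  choose! pos hpos using fun g : {g : ℕ → ℕ → ℕ // IsGT p a g} =>
    exists_gtFirst (p := p) (lam := lam) (g := g.1)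
  have hgood : ∀ g : {g : ℕ → ℕ → ℕ // IsGT p a g},
      g ∈ univ.filter (fun g : {g : ℕ → ℕ → ℕ // IsGT p a g} => ¬ GTGood p lam g.1) →
      GTFirst p lam g.1 (pos g).1 (pos g).2 := fun g hg => hpos g (mem_filter.1 hg).2
  let inv : ∀ g : {g : ℕ → ℕ → ℕ // IsGT p a g},
      g ∈ univ.filter (fun g : {g : ℕ → ℕ → ℕ // IsGT p a g} => ¬ GTGood p lam g.1) →
      {g : ℕ → ℕ → ℕ // IsGT p a g} := fun g hg =>
    ⟨gtFlip (pos g).1 (pos g).2 (gtThreshold lam g.1 (pos g).1 (pos g).2) g.1,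
      isGT_gtFlip g.2 (hgood g hg).1 (hgood g hg).le_threshold ((hgood g hg).threshold_le hlam g.2)⟩
  have hinv : ∀ g hg, GTFirst p lam (inv g hg).1 (pos g).1 (pos g).2 :=
    fun g hg => ((hgood g hg).flip g.2).1
  have hmem : ∀ g hg, inv g hg ∈
      univ.filter (fun g : {g : ℕ → ℕ → ℕ // IsGT p a g} => ¬ GTGood p lam g.1) :=
    fun g hg => mem_filter.2 ⟨mem_univ _, fun h => h _ _ (hinv g hg).1 (hinv g hg).2.1⟩
  have hadd : ∀ g hg, deltaAlt p (fun k => lam k + gtWeight p g.1 k)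
      + deltaAlt p (fun k => lam k + gtWeight p (inv g hg).1 k) = 0 := by
    intro g hg
    obtain ⟨h1, h2, h3⟩ := (hgood g hg).weight_flip hlam g.2
    refine deltaAlt_add_deltaAlt (hgood g hg).1 h3.symm h2.symm fun j hj hj' => ?_
    exact congrArg _ (h1 j hj hj').symm
  refine sum_involution inv hadd (fun g hg hne heq => hne ?_) hmem fun g hg => Subtype.ext ?_
  · have := hadd g hg
    rwa [heq, ← two_mul, mul_eq_zero, or_iff_right two_ne_zero] at this
  · have h1 := (hgood _ (hmem g hg)).unique (hinv g hg)
    have h2 := ((hgood g hg).flip g.2).2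
    change gtFlip (pos (inv g hg)).1 (pos (inv g hg)).2 (gtThreshold lam (inv g hg).1
      (pos (inv g hg)).1 (pos (inv g hg)).2) (inv g hg).1 = _
    rw [h1.1, h1.2]
    change gtFlip (pos g).1 (pos g).2 (gtThreshold lam (gtFlip _ _ _ _) (pos g).1 (pos g).2)
      (gtFlip _ _ _ _) = _
    rw [h2]
    exact gtFlip_gtFlip g.2 (hgood g hg).le_threshold ((hgood g hg).threshold_le hlam g.2)

/-- The pattern whose level `k` consists of the first `k` parts of `a`. -/
def gtSuper (a : ℕ → ℕ) : ℕ → ℕ → ℕ := fun k i => if i < k then a i else 0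

theorem isGT_gtSuper {p : ℕ} {a : ℕ → ℕ} (ha : Antitone a) (hp : ∀ i, p ≤ i → a i = 0) :
    IsGT p a (gtSuper a) := by
  refine ⟨fun i => by simp [gtSuper], fun k i hk => ?_, fun k i => ?_, fun k i => ?_⟩
  · unfold gtSuper
    split_ifs with h
    · rfl
    · exact (hp i (by omega)).symm
  · unfold gtSuper
    split_ifs <;> omega
  · unfold gtSuper
    have := ha (Nat.le_succ i)
    split_ifs <;> omega

theorem gtSum_gtSuper (a : ℕ → ℕ) (k i : ℕ) :
    gtSum (gtSuper a) k i = ∑ j ∈ range (min k i), a j := by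
  unfold gtSum gtSuper
  rw [← sum_filter]
  refine sum_congr ?_ fun _ _ => rfl
  ext j
  simp
  omega

theorem gtGood_zero_iff {p : ℕ} {a : ℕ → ℕ} {g : ℕ → ℕ → ℕ} (h : IsGT p a g) :
    GTGood p (fun _ => 0) g ↔ g = gtSuper a := by
  constructor
  · intro hg
    suffices H : ∀ i, ∀ k, i < k → g k i = a i by
      funext k i
      unfold gtSuper
      split_ifs with hi
      · exact H i k hi
      · exact h.eq_zero (by omega)
    intro i
    induction i using Nat.strong_induction_on with
    | _ i ih =>
      have hs : ∀ k, i ≤ k → gtSum g k i = gtSum g (k + 1) i := fun k hk =>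
        sum_congr rfl fun j hj => by
          have := mem_range.1 hj
          rw [ih j this k (by omega), ih j this (k + 1) (by omega)]
      have hstep : ∀ k, i ≤ k → g (k + 1) i = g (k + 2) i := by
        intro k hk
        rcases le_or_gt p (k + 1) with hp | hp
        · rw [h.top _ _ hp, h.top _ _ (by omega)]
        · have h1 := hg k i hp
          unfold GTViol at h1
          have h2 := hs k hk
          have h3 : gtSum g (k + 1) i = gtSum g (k + 2) i := hs (k + 1) (by omega)
          have h4 : g (k + 1) i ≤ g (k + 2) i := h.mono (k + 1) i
          rw [gtSum_succ, gtSum_succ] at h1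
          dsimp only at h1
          omega
      intro k hk
      have hconst : ∀ m, g (i + 1 + m) i = g (i + 1) i := by
        intro m
        induction m with
        | zero => rfl
        | succ m ihm => 
          rw [← ihm, show i + 1 + (m + 1) = i + m + 2 by omega, show i + 1 + m = i + m + 1 by omega]
          exact (hstep (i + m) (by omega)).symm
      rw [← h.top (k + p) i (by omega), show k = i + 1 + (k - i - 1) by omega, hconst,
        show i + 1 + (k - i - 1) + p = i + 1 + (k - i - 1 + p) by omega, hconst]
  · rintro rfl k i hk hv
    unfold GTViol at hv
    simp only [gtSum_gtSuper] at hv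
    rcases lt_trichotomy i k with hi | rfl | hi
    · rw [min_eq_right (by omega), min_eq_right (by omega), min_eq_right (by omega),
        min_eq_right (by omega)] at hv
      omega
    · rw [min_eq_left (by omega), min_eq_right (by omega), min_eq_right (by omega),
        min_eq_right (by omega)] at hv
      omega
    · rw [min_eq_left (by omega), min_eq_left (by omega), min_eq_left (a := k) (by omega),
        min_eq_left (by omega), sum_range_succ _ (k + 1), sum_range_succ _ k] at hv
      have : a (k + 1) ≤ a k := h.antitone (Nat.le_succ k)
      omega

theorem gtWeight_gtSuper {p : ℕ} {a : ℕ → ℕ} {k : ℕ} (hk : k < p) :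
    gtWeight p (gtSuper a) k = a k := by
  unfold gtWeight
  rw [gtSum_gtSuper, gtSum_gtSuper, min_eq_left (by omega), min_eq_left (by omega),
    sum_range_succ]
  omega

/-- The bialternant formula. -/
theorem deltaAlt_eq {p : ℕ} {a : ℕ → ℕ} (ha : Antitone a) (hp : ∀ i, p ≤ i → a i = 0) :
    deltaAlt p a = deltaAlt p (fun _ => 0) * schur MvPolynomial.X a := by
  rw [deltaAlt_mul_schur antitone_const, sum_eq_single ⟨gtSuper a, isGT_gtSuper ha hp⟩]
  · refine deltaAlt_congr fun k hk => ?_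
    rw [gtWeight_gtSuper hk, zero_add]
  · intro g hg hne
    exact absurd (Subtype.ext ((gtGood_zero_iff g.2).1 (mem_filter.1 hg).2)) hne
  · intro h
    exact (h (mem_filter.2 ⟨mem_univ _, (gtGood_zero_iff (isGT_gtSuper ha hp)).2 rfl⟩)).elim

theorem IsGT.weight_eq_zero {p : ℕ} {a : ℕ → ℕ} {g : ℕ → ℕ → ℕ} (h : IsGT p a g) {k : ℕ}
    (hk : p ≤ k) : gtWeight p g k = 0 := by
  have : gtSum g (k + 1) p = gtSum g k p := sum_congr rfl fun j _ => by
    rw [h.top _ _ hk, h.top _ _ (by omega)]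
  simp [gtWeight, this]

theorem GTGood.antitone_add {p : ℕ} {lam a : ℕ → ℕ} {g : ℕ → ℕ → ℕ} (hlam : Antitone lam)
    (h : IsGT p a g) (hg : GTGood p lam g) : Antitone fun k => lam k + gtWeight p g k := by
  refine antitone_nat_of_succ_le fun k => ?_
  rcases le_or_gt p (k + 1) with hk | hk
  · rw [h.weight_eq_zero hk]
    exact (hlam (Nat.le_succ k)).trans (Nat.le_add_right _ _)
  · have h1 := hg k p hk
    unfold GTViol at h1
    have h2 := h.weight_add k
    have h3 : gtSum g (k + 1) p + gtWeight p g (k + 1) = gtSum g (k + 2) p := h.weight_add (k + 1)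
    rw [gtSum_succ, gtSum_succ, h.eq_zero (k := k + 1) (by omega),
      h.eq_zero (k := k + 2) (by omega)] at h1
    omega

theorem sum_gtWeight {p : ℕ} {a : ℕ → ℕ} {g : ℕ → ℕ → ℕ} (h : IsGT p a g) :
    ∑ k ∈ range p, gtWeight p g k = ∑ i ∈ range p, a i := by
  have : ∀ k, ∑ j ∈ range k, gtWeight p g j = gtSum g k p := by
    intro k
    induction k with
    | zero => simp [h.gtSum_zero_level]
    | succ k ih => rw [sum_range_succ, ih, h.weight_add]
  rw [this]
  exact sum_congr rfl fun i _ => h.top _ _ le_rfl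

theorem X_schur_mul_schur {p : ℕ} {lam : ℕ → ℕ} (hlam : Antitone lam)
    (hp : ∀ i, p ≤ i → lam i = 0) (a : ℕ → ℕ) :
    schur (MvPolynomial.X : Fin p → MvPolynomial (Fin p) ℤ) lam * schur MvPolynomial.X a
      = ∑ g : {g : ℕ → ℕ → ℕ // IsGT p a g} with GTGood p lam g.1,
          schur MvPolynomial.X (fun k => lam k + gtWeight p g.1 k) := by
  apply mul_left_cancel₀ (deltaAlt_ne_zero p)
  rw [← mul_assoc, ← deltaAlt_eq hlam hp, deltaAlt_mul_schur hlam, mul_sum]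
  refine sum_congr rfl fun g hg => deltaAlt_eq ((mem_filter.1 hg).2.antitone_add hlam g.2) ?_
  intro i hi
  rw [hp i hi, g.2.weight_eq_zero hi]

theorem schur_aeval {R : Type*} [CommRing R] {p : ℕ} (x : Fin p → R) (a : ℕ → ℕ) :
    MvPolynomial.aeval x (schur (MvPolynomial.X : Fin p → MvPolynomial (Fin p) ℤ) a)
      = schur x a := by
  have := map_schur (MvPolynomial.aeval (R := ℤ) x).toRingHom
    (MvPolynomial.X : Fin p → MvPolynomial (Fin p) ℤ) a
  simpa using this

/-- The Littlewood–Richardson rule, in terms of patterns. -/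
theorem schur_mul_schur {R : Type*} [CommRing R] {p : ℕ} (x : Fin p → R) {lam : ℕ → ℕ}
    (hlam : Antitone lam) (hp : ∀ i, p ≤ i → lam i = 0) (a : ℕ → ℕ) :
    schur x lam * schur x a = ∑ g : {g : ℕ → ℕ → ℕ // IsGT p a g} with GTGood p lam g.1,
      schur x (fun k => lam k + gtWeight p g.1 k) := by
  have := congrArg (MvPolynomial.aeval x) (X_schur_mul_schur hlam hp a)
  rw [map_mul, map_sum] at this
  simpa only [schur_aeval] using this

/-- The elementary symmetric function of degree `b`, as a sum over binary vectors. -/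
def elemSym {R : Type*} [CommRing R] {p : ℕ} (x : Fin p → R) (b : ℕ) : R :=
  ∑ v : {v : Fin p → Fin 2 // ∑ i, (v i : ℕ) = b}, ∏ i, x i ^ (v.1 i : ℕ)

open MvPolynomial in
theorem rename_elemSym {p : ℕ} (b : ℕ) (σ : Perm (Fin p)) :
    rename σ (elemSym (X : Fin p → MvPolynomial (Fin p) ℤ) b) = elemSym X b := by
  unfold elemSym
  rw [map_sum]
  refine Fintype.sum_equiv ((Equiv.arrowCongr σ (Equiv.refl (Fin 2))).subtypeEquiv ?_) _ _ ?_
  · intro v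
    rw [← Equiv.sum_comp σ.symm]
    simp [Equiv.arrowCongr]
  · intro v
    rw [map_prod, ← Equiv.prod_comp σ fun i => (X i : MvPolynomial (Fin p) ℤ) ^ _]
    simp [Equiv.arrowCongr]

theorem extc_of_lt {p : ℕ} (l : Fin p → ℕ) (i : Fin p) : extc l i = l i := by
  simp [extc]

theorem extc_of_ge {p : ℕ} (l : Fin p → ℕ) {i : ℕ} (hi : p ≤ i) : extc l i = 0 := by
  simp [extc, hi]

theorem sum_extc {p : ℕ} (l : Fin p → ℕ) : ∑ i ∈ range p, extc l i = ∑ i, l i := by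
  rw [← Fin.sum_univ_eq_sum_range]
  exact sum_congr rfl fun i _ => extc_of_lt l i

/-- Add a binary vector to a sequence. -/
def addVec {p : ℕ} (lam : ℕ → ℕ) (v : Fin p → Fin 2) : ℕ → ℕ :=
  fun k => lam k + extc (fun i => (v i : ℕ)) k

theorem addVec_le {p : ℕ} (lam : ℕ → ℕ) (v : Fin p → Fin 2) (k : ℕ) :
    addVec lam v k ≤ lam k + 1 := by
  unfold addVec extc
  split_ifs with h
  · have := (v ⟨k, h⟩).2
    dsimp only
    omega
  · omega

theorem X_schur_mul_elemSym {p : ℕ} {lam : ℕ → ℕ} (hlam : Antitone lam)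
    (hp : ∀ i, p ≤ i → lam i = 0) (b : ℕ) :
    schur (MvPolynomial.X : Fin p → MvPolynomial (Fin p) ℤ) lam * elemSym MvPolynomial.X b
      = ∑ v : {v : Fin p → Fin 2 // ∑ i, (v i : ℕ) = b} with Antitone (addVec lam v.1),
          schur MvPolynomial.X (addVec lam v.1) := by
  apply mul_left_cancel₀ (deltaAlt_ne_zero p)
  have h0 : deltaAlt p lam * elemSym MvPolynomial.X b
      = ∑ v : {v : Fin p → Fin 2 // ∑ i, (v i : ℕ) = b}, deltaAlt p (addVec lam v.1) := by
    have := alternant_mul (T := {v : Fin p → Fin 2 // ∑ i, (v i : ℕ) = b})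
      (fun k : Fin p => lam k + (p - 1 - k)) (fun v i => (v.1 i : ℕ))
      fun σ => rename_elemSym b σ
    refine this.trans (sum_congr rfl fun v _ => ?_)
    unfold deltaAlt addVec
    congr 1
    funext k
    rw [extc_of_lt]
    exact Nat.add_right_comm _ _ _
  rw [← mul_assoc, ← deltaAlt_eq hlam hp, h0, mul_sum, sum_filter]
  refine sum_congr rfl fun v _ => ?_
  have hz : ∀ i, p ≤ i → addVec lam v.1 i = 0 := fun i hi => by
    simp [addVec, hp i hi, extc_of_ge _ hi]
  split_ifs with h
  · exact deltaAlt_eq h hz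
  · have : ∃ k, addVec lam v.1 k < addVec lam v.1 (k + 1) := by
      by_contra! hc
      exact h (antitone_nat_of_succ_le hc)
    obtain ⟨k, hk⟩ := this
    have hkp : k + 1 < p := by
      by_contra hc
      rw [hz (k + 1) (by omega)] at hk
      omega
    refine deltaAlt_eq_zero hkp ?_
    have h1 := addVec_le lam v.1 (k + 1)
    have h2 : lam k ≤ addVec lam v.1 k := Nat.le_add_right _ _
    have h3 : lam (k + 1) ≤ lam k := hlam (Nat.le_succ k)
    omega

theorem elemSym_aeval {R : Type*} [CommRing R] {p : ℕ} (x : Fin p → R) (b : ℕ) :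
    MvPolynomial.aeval x (elemSym (MvPolynomial.X : Fin p → MvPolynomial (Fin p) ℤ) b)
      = elemSym x b := by
  simp [elemSym, map_sum, map_prod]

/-- The Pieri rule, in terms of binary vectors. -/
theorem schur_mul_elemSym {R : Type*} [CommRing R] {p : ℕ} (x : Fin p → R) {lam : ℕ → ℕ}
    (hlam : Antitone lam) (hp : ∀ i, p ≤ i → lam i = 0) (b : ℕ) :
    schur x lam * elemSym x b
      = ∑ v : {v : Fin p → Fin 2 // ∑ i, (v i : ℕ) = b} with Antitone (addVec lam v.1),
          schur x (addVec lam v.1) := by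
  have := congrArg (MvPolynomial.aeval x) (X_schur_mul_elemSym hlam hp b)
  rw [map_mul, map_sum, elemSym_aeval] at this
  simpa only [schur_aeval] using this

theorem mul_prod_eq_sum_chain {R V : Type*} [CommRing R] [Fintype V] (s : V → R) (sz : V → ℕ)
    (n : ℕ) {r : ℕ} (f : Fin r → R) (w : Fin r → V → V → R) (d : Fin r → ℕ)
    (hw : ∀ k u v, w k u v ≠ 0 → sz v = sz u + d k)
    (hf : ∀ k u, sz u + d k ≤ n → s u * f k = ∑ v, w k u v * s v)
    (u : V) (hu : sz u + ∑ k, d k ≤ n) :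
    s u * ∏ k, f k = ∑ c : Fin (r + 1) → V,
      if c 0 = u then (∏ k, w k (c k.castSucc) (c k.succ)) * s (c (Fin.last r)) else 0 := by
  induction r generalizing u with
  | zero =>
    rw [Fintype.sum_eq_single (fun _ => u)]
    · simp
    · intro c hc
      rw [if_neg]
      rintro rfl
      exact hc (funext fun i => by rw [Fin.fin_one_eq_zero i])
  | succ r ih =>
    rw [Fin.sum_univ_succ] at hu
    rw [Fin.prod_univ_succ, ← mul_assoc, hf 0 u (by omega), sum_mul]
    have h1 : ∀ v, w 0 u v * s v * ∏ k : Fin r, f k.succ = ∑ c : Fin (r + 1) → V,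
        if c 0 = v then w 0 u v * ((∏ k : Fin r, w k.succ (c k.castSucc) (c k.succ)) *
          s (c (Fin.last r))) else 0 := by
      intro v
      by_cases h0 : w 0 u v = 0
      · simp [h0]
      · have := hw _ _ _ h0
        rw [mul_assoc, ih (fun k => f k.succ) (fun k => w k.succ) (fun k => d k.succ)
          (fun k => hw k.succ) (fun k => hf k.succ) v (by omega), mul_sum]
        simp only [mul_ite, mul_zero]
    rw [sum_congr rfl fun v _ => h1 v, sum_comm]
    rw [← Equiv.sum_comp (Fin.consEquiv fun _ : Fin (r + 2) => V), Fintype.sum_prod_type,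
      Fintype.sum_eq_single u]
    · refine sum_congr rfl fun c _ => ?_
      rw [Fintype.sum_eq_single (c 0) fun v hv => if_neg (Ne.symm hv)]
      rw [Fin.prod_univ_succ]
      simp [Fin.consEquiv, ← Fin.succ_last, mul_assoc]
    · intro v hv
      refine sum_eq_zero fun c _ => ?_
      simp [Fin.consEquiv, hv]

/-- Partitions of size at most `n`. -/
abbrev PB (n : ℕ) : Type :=
  {a : ℕ → ℕ // Antitone a ∧ (∀ i, n ≤ i → a i = 0) ∧ ∑ i ∈ range n, a i ≤ n}

/-- The size of a partition. -/
def PB.size {n : ℕ} (a : PB n) : ℕ := ∑ i ∈ range n, a.1 i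

instance (n : ℕ) : Finite (PB n) := by
  let F : PB n → (Fin n → Fin (n + 1)) := fun a i => ⟨a.1 i, Nat.lt_succ_of_le
    ((single_le_sum (fun _ _ => Nat.zero_le _) (mem_range.2 i.2)).trans a.2.2.2)⟩
  refine Finite.of_injective F fun a b hab => Subtype.ext (funext fun i => ?_)
  rcases le_or_gt n i with hi | hi
  · rw [a.2.2.1 i hi, b.2.2.1 i hi]
  · exact congrArg Fin.val (congrFun hab ⟨i, hi⟩)

instance (n : ℕ) : Fintype (PB n) := Fintype.ofFinite _

/-- The empty partition. -/
def PB.empty (n : ℕ) : PB n := ⟨fun _ => 0, antitone_const, by simp, by simp⟩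

theorem PB.size_empty (n : ℕ) : (PB.empty n).size = 0 := by simp [PB.size, PB.empty]

theorem sum_range_eq_of_support {a : ℕ → ℕ} {m k : ℕ} (hm : ∀ i, m ≤ i → a i = 0)
    (hk : ∀ i, k ≤ i → a i = 0) : ∑ i ∈ range m, a i = ∑ i ∈ range k, a i := by
  wlog h : m ≤ k generalizing m k
  · exact (this hk hm (by omega)).symm
  · refine sum_subset (range_mono h) fun i _ hi => hm i ?_
    simpa using hi

theorem support_of_antitone {a : ℕ → ℕ} (ha : Antitone a) {m n : ℕ} (hm : ∀ i, m ≤ i → a i = 0)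
    (hn : ∑ i ∈ range m, a i ≤ n) : ∀ i, n ≤ i → a i = 0 := by
  intro i hi
  by_contra h
  have him : i < m := by
    by_contra hc
    exact h (hm i (by omega))
  have h1 : ∑ j ∈ range (i + 1), 1 ≤ ∑ j ∈ range (i + 1), a j := sum_le_sum fun j hj => by
    have : a i ≤ a j := ha (by simpa [Nat.lt_succ_iff] using hj)
    omega
  have h2 : ∑ j ∈ range (i + 1), a j ≤ ∑ j ∈ range m, a j :=
    sum_le_sum_of_subset (range_mono (by omega))
  simp at h1
  omega

/-- A finitely supported antitone sequence of small sum as an element of `PB n`. -/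
def PB.mk {n m : ℕ} {a : ℕ → ℕ} (ha : Antitone a) (hm : ∀ i, m ≤ i → a i = 0)
    (hn : ∑ i ∈ range m, a i ≤ n) : PB n :=
  ⟨a, ha, support_of_antitone ha hm hn, by
    rwa [sum_range_eq_of_support (support_of_antitone ha hm hn) hm]⟩

theorem PB.size_eq {n m : ℕ} (a : PB n) (hm : ∀ i, m ≤ i → a.1 i = 0) :
    a.size = ∑ i ∈ range m, a.1 i :=
  sum_range_eq_of_support a.2.2.1 hm

theorem sum_filter_eq_sum_PB {R G : Type*} [CommRing R] [Fintype G] (n : ℕ) (P : G → Prop)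
    (φ : G → ℕ → ℕ) (F : (ℕ → ℕ) → R) (h : ∀ g, P g → ∃ κ : PB n, φ g = κ.1) :
    ∑ g with P g, F (φ g) = ∑ κ : PB n, (Nat.card {g // P g ∧ φ g = κ.1} : R) * F κ.1 := by
  have h1 : ∀ κ : PB n, (Nat.card {g // P g ∧ φ g = κ.1} : R) * F κ.1
      = ∑ g with P g, if φ g = κ.1 then F (φ g) else 0 := by
    intro κ
    rw [← sum_filter, filter_filter, Nat.card_eq_fintype_card, Fintype.card_subtype,
      ← nsmul_eq_mul, ← sum_const]
    exact sum_congr rfl fun g hg => by rw [(mem_filter.1 hg).2.2]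
  rw [sum_congr rfl fun κ _ => h1 κ, sum_comm]
  refine sum_congr rfl fun g hg => ?_
  obtain ⟨κ, hκ⟩ := h g (mem_filter.1 hg).2
  rw [Fintype.sum_eq_single κ fun κ' hκ' => if_neg fun h' => hκ' (Subtype.ext (h'.symm.trans hκ)),
    if_pos hκ]

theorem schur_mul_schur_PB {R : Type*} [CommRing R] {p n : ℕ} (x : Fin p → R) (lam mu : PB n)
    (hp : ∀ i, p ≤ i → lam.1 i = 0) (hn : lam.size + mu.size ≤ n) :
    schur x lam.1 * schur x mu.1 = ∑ κ : PB n, (Nat.card {g : {g : ℕ → ℕ → ℕ // IsGT p mu.1 g} //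
      GTGood p lam.1 g.1 ∧ (fun k => lam.1 k + gtWeight p g.1 k) = κ.1} : R) * schur x κ.1 := by
  rw [schur_mul_schur x lam.2.1 hp, ← sum_filter_eq_sum_PB n
    (fun g : {g : ℕ → ℕ → ℕ // IsGT p mu.1 g} => GTGood p lam.1 g.1)
    (fun g k => lam.1 k + gtWeight p g.1 k)]
  intro g hg
  refine ⟨PB.mk (hg.antitone_add lam.2.1 g.2) (m := p) (fun i hi => ?_) ?_, rfl⟩
  · rw [hp i hi, g.2.weight_eq_zero hi]
  · rw [sum_add_distrib, sum_gtWeight g.2, ← lam.size_eq hp,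
      ← mu.size_eq fun i hi => g.2.top_eq_zero hi]
    exact hn

/-- `κ/lam` is a vertical strip of size `b`. -/
def VStrip {n : ℕ} (b : ℕ) (lam κ : PB n) : Prop :=
  (∀ i, lam.1 i ≤ κ.1 i ∧ κ.1 i ≤ lam.1 i + 1) ∧ κ.size = lam.size + b

theorem unique_addVec {n p b : ℕ} {lam κ : PB n} (hp : ∀ i, p ≤ i → lam.1 i = 0)
    (hκ : ∀ i, p ≤ i → κ.1 i = 0) (hV : VStrip b lam κ) :
    Nonempty (Unique {v : {v : Fin p → Fin 2 // ∑ i, (v i : ℕ) = b} //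
      Antitone (addVec lam.1 v.1) ∧ addVec lam.1 v.1 = κ.1}) := by
  let v : Fin p → Fin 2 := fun i => ⟨κ.1 i - lam.1 i, by have := hV.1 i; omega⟩
  have hv : addVec lam.1 v = κ.1 := by
    funext k
    unfold addVec
    rcases lt_or_ge k p with hk | hk
    · rw [extc_of_lt (fun i => (v i : ℕ)) ⟨k, hk⟩]
      have := hV.1 k
      simp only [v]
      omega
    · rw [extc_of_ge _ hk, hp k hk, hκ k hk]
  have hs : ∑ i, (v i : ℕ) = b := by
    have h1 := hV.2
    rw [κ.size_eq hκ, ← hv, lam.size_eq hp] at h1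
    simp only [addVec] at h1
    rw [sum_add_distrib, sum_extc] at h1
    omega
  refine ⟨⟨⟨⟨⟨v, hs⟩, by rw [hv]; exact κ.2.1, hv⟩⟩, fun u => Subtype.ext (Subtype.ext ?_)⟩⟩
  funext i
  have h1 := congrFun u.2.2 i
  unfold addVec at h1
  rw [extc_of_lt] at h1
  refine Fin.ext ?_
  change _ = κ.1 i - lam.1 i
  omega

theorem schur_mul_elemSym_PB {R : Type*} [CommRing R] {p n : ℕ} (x : Fin p → R) (lam : PB n)
    (b : ℕ) (hn : lam.size + b ≤ n) :
    schur x lam.1 * elemSym x b = ∑ κ : PB n, (if VStrip b lam κ then 1 else 0) * schur x κ.1 := by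
  by_cases hp : ∀ i, p ≤ i → lam.1 i = 0
  · have hz : ∀ v : Fin p → Fin 2, ∀ i, p ≤ i → addVec lam.1 v i = 0 := fun v i hi => by
      simp [addVec, hp i hi, extc_of_ge _ hi]
    have hsum : ∀ v : Fin p → Fin 2, ∑ i ∈ range p, addVec lam.1 v i
        = lam.size + ∑ i, (v i : ℕ) := fun v => by
      simp only [addVec]
      rw [sum_add_distrib, sum_extc, lam.size_eq hp]
    have h := sum_filter_eq_sum_PB n
      (fun v : {v : Fin p → Fin 2 // ∑ i, (v i : ℕ) = b} => Antitone (addVec lam.1 v.1))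
      (fun v => addVec lam.1 v.1) (schur x)
    rw [schur_mul_elemSym x lam.2.1 hp]
    refine Eq.trans (by congr!) ((h ?_).trans ?_)
    · intro v hv
      exact ⟨PB.mk hv (hz v.1) (by rw [hsum, v.2]; exact hn), rfl⟩
    · refine sum_congr rfl fun κ _ => ?_
      by_cases hκ : ∀ i, p ≤ i → κ.1 i = 0
      · congr 1
        split_ifs with hV
        · have : Unique {v : {v : Fin p → Fin 2 // ∑ i, (v i : ℕ) = b} //
              Antitone (addVec lam.1 v.1) ∧ addVec lam.1 v.1 = κ.1} :=
            Classical.choice (unique_addVec hp hκ hV)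
          rw [Nat.card_unique, Nat.cast_one]
        · have : IsEmpty {v : {v : Fin p → Fin 2 // ∑ i, (v i : ℕ) = b} //
              Antitone (addVec lam.1 v.1) ∧ addVec lam.1 v.1 = κ.1} := by
            refine ⟨fun v => hV ⟨fun i => ?_, ?_⟩⟩
            · rw [← v.2.2]
              exact ⟨Nat.le_add_right _ _, addVec_le _ _ _⟩
            · rw [κ.size_eq hκ, ← v.2.2, hsum, v.1.2]
          rw [Nat.card_of_isEmpty, Nat.cast_zero]
      · rw [schur_eq_zero x hκ, mul_zero, mul_zero]
  · rw [schur_eq_zero x hp, zero_mul]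
    refine (sum_eq_zero fun κ _ => ?_).symm
    by_cases hV : VStrip b lam κ
    · rw [schur_eq_zero x, mul_zero]
      intro h
      exact hp fun i hi => Nat.le_zero.1 ((hV.1 i).1.trans (h i hi).le)
    · simp [hV]

theorem card_cells {C : ℕ × ℕ → Prop} (K : ℕ) (s : ℕ → Finset ℕ)
    (h : ∀ i j, C (i, j) ↔ i < K ∧ j ∈ s i) :
    Nat.card {p : ℕ × ℕ // C p} = ∑ i ∈ range K, (s i).card := by
  let e : {p : ℕ × ℕ // C p} ≃ (range K).sigma s :=
    (Equiv.sigmaEquivProd ℕ ℕ).symm.subtypeEquiv fun p => by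
      rw [mem_sigma, mem_range]
      exact h p.1 p.2
  rw [Nat.card_congr e, Nat.card_eq_fintype_card, Fintype.card_coe, card_sigma]

/-- `E i k` bounds the columns of the entries less than `k` in row `i` of the filling `T` of
the skew shape `a/b`. -/
structure IsThrOf (a b : ℕ → ℕ) (T E : ℕ → ℕ → ℕ) : Prop where
  ge : ∀ i k, b i ≤ E i k
  le : ∀ i k, E i k ≤ a i
  spec : ∀ i j k, b i ≤ j → j < a i → (j < E i k ↔ T i j < k)

/-- The threshold functions of fillings of `a/b` with weakly increasing rows. -/
structure IsThr (a b : ℕ → ℕ) (E : ℕ → ℕ → ℕ) : Prop where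
  zero : ∀ i, E i 0 = b i
  mono : ∀ i k, E i k ≤ E i (k + 1)
  top : ∀ i, ∃ K, ∀ k, K ≤ k → E i k = a i

/-- Fillings of `a/b` with weakly increasing rows. -/
def IsRowFill (a b : ℕ → ℕ) (T : ℕ → ℕ → ℕ) : Prop :=
  (∀ i j, ¬(b i ≤ j ∧ j < a i) → T i j = 0) ∧
  (∀ i j₁ j₂, b i ≤ j₁ → j₁ ≤ j₂ → j₂ < a i → T i j₁ ≤ T i j₂)

/-- The threshold function of a filling. -/
def thrOf (a b : ℕ → ℕ) (T : ℕ → ℕ → ℕ) (i k : ℕ) : ℕ :=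
  b i + ((Ico (b i) (a i)).filter fun j => T i j < k).card

/-- The filling with a given threshold function. -/
def fillOf (a b : ℕ → ℕ) (E : ℕ → ℕ → ℕ) (i j : ℕ) : ℕ :=
  if b i ≤ j ∧ j < a i then sInf {k | j < E i (k + 1)} else 0

variable {a b : ℕ → ℕ} {T E : ℕ → ℕ → ℕ}

theorem IsThr.mono_le (h : IsThr a b E) (i : ℕ) : Monotone (E i) :=
  monotone_nat_of_le_succ (h.mono i)

theorem IsThr.ge (h : IsThr a b E) (i k : ℕ) : b i ≤ E i k := by
  rw [← h.zero i]; exact h.mono_le i (Nat.zero_le k)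

theorem IsThr.le (h : IsThr a b E) (i k : ℕ) : E i k ≤ a i := by
  obtain ⟨K, hK⟩ := h.top i
  rw [← hK (max k K) (le_max_right _ _)]
  exact h.mono_le i (le_max_left _ _)

theorem isThrOf_thrOf (hba : ∀ i, b i ≤ a i) (h : IsRowFill a b T) :
    IsThrOf a b T (thrOf a b T) := by
  refine ⟨fun i k => Nat.le_add_right _ _, fun i k => ?_, fun i j k hj hj' => ⟨fun hlt => ?_,
    fun hlt => ?_⟩⟩
  · have := card_filter_le (Ico (b i) (a i)) fun j => T i j < k
    rw [Nat.card_Ico] at this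
    have := hba i
    unfold thrOf
    omega
  · by_contra hc
    have : ((Ico (b i) (a i)).filter fun j => T i j < k) ⊆ Ico (b i) j := by
      intro j' hj''
      rw [mem_filter, mem_Ico] at hj''
      rw [mem_Ico]
      refine ⟨hj''.1.1, ?_⟩
      by_contra hjj
      have := h.2 i j j' hj (by omega) hj''.1.2
      omega
    have := card_le_card this
    rw [Nat.card_Ico] at this
    unfold thrOf at hlt
    omega
  · have : Ico (b i) (j + 1) ⊆ ((Ico (b i) (a i)).filter fun j => T i j < k) := by
      intro j' hj''
      rw [mem_Ico] at hj''
      rw [mem_filter, mem_Ico]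
      have := h.2 i j' j hj''.1 (by omega) hj'
      omega
    have := card_le_card this
    rw [Nat.card_Ico] at this
    unfold thrOf
    omega

theorem IsThrOf.eq {E' : ℕ → ℕ → ℕ} (h : IsThrOf a b T E) (h' : IsThrOf a b T E') : E = E' := by
  funext i k
  have h1 := h.ge i k
  have h2 := h'.ge i k
  have h3 := h.le i k
  have h4 := h'.le i k
  rcases lt_trichotomy (E i k) (E' i k) with hlt | he | hlt
  · have := (h.spec i (E i k) k h1 (by omega)).trans (h'.spec i (E i k) k h1 (by omega)).symm
    omega
  · exact he
  · have := (h.spec i (E' i k) k h2 (by omega)).trans (h'.spec i (E' i k) k h2 (by omega)).symm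
    omega

theorem IsThrOf.eq_fill {T' : ℕ → ℕ → ℕ} (h : IsThrOf a b T E) (h' : IsThrOf a b T' E)
    (hT : IsRowFill a b T) (hT' : IsRowFill a b T') : T = T' := by
  funext i j
  by_cases hij : b i ≤ j ∧ j < a i
  · have h1 := fun k => (h.spec i j k hij.1 hij.2).symm.trans (h'.spec i j k hij.1 hij.2)
    have h2 := h1 (T i j)
    have h3 := h1 (T' i j)
    omega
  · rw [hT.1 i j hij, hT'.1 i j hij]

theorem isThr_thrOf (hba : ∀ i, b i ≤ a i) : IsThr a b (thrOf a b T) := by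
  refine ⟨fun i => by simp [thrOf], fun i k => ?_, fun i => ?_⟩
  · refine Nat.add_le_add_left (card_le_card fun j hj => ?_) _
    rw [mem_filter] at hj ⊢
    exact ⟨hj.1, by omega⟩
  · refine ⟨(Ico (b i) (a i)).sup (T i) + 1, fun k hk => ?_⟩
    unfold thrOf
    rw [filter_true_of_mem, Nat.card_Ico]
    · have := hba i; omega
    · intro j hj
      have : T i j ≤ (Ico (b i) (a i)).sup (T i) := le_sup hj
      omega

theorem isThrOf_fillOf (h : IsThr a b E) : IsThrOf a b (fillOf a b E) E := by
  refine ⟨h.ge, h.le, fun i j k hj hj' => ?_⟩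
  obtain ⟨K, hK⟩ := h.top i
  have hne : {k | j < E i (k + 1)}.Nonempty := ⟨K, by
    change j < E i (K + 1)
    rw [hK _ (by omega)]; exact hj'⟩
  rw [fillOf, if_pos ⟨hj, hj'⟩]
  constructor
  · intro hlt
    cases k with
    | zero => rw [h.zero] at hlt; omega
    | succ k => exact Nat.lt_succ_of_le (Nat.sInf_le hlt)
  · intro hlt
    have h1 : j < E i (sInf {k | j < E i (k + 1)} + 1) := Nat.sInf_mem hne
    exact h1.trans_le (h.mono_le i hlt)

theorem isRowFill_fillOf (h : IsThr a b E) : IsRowFill a b (fillOf a b E) := by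
  refine ⟨fun i j hij => if_neg hij, fun i j₁ j₂ h1 h2 h3 => ?_⟩
  have hs := isThrOf_fillOf h
  have h4 := hs.spec i j₁ (fillOf a b E i j₂ + 1) h1 (by omega)
  have h5 := hs.spec i j₂ (fillOf a b E i j₂ + 1) (by omega) h3
  omega

/-- Fillings with weakly increasing rows correspond to threshold functions. -/
def thrEquiv (a b : ℕ → ℕ) (hba : ∀ i, b i ≤ a i) :
    {T // IsRowFill a b T} ≃ {E // IsThr a b E} where
  toFun T := ⟨thrOf a b T.1, isThr_thrOf hba⟩
  invFun E := ⟨fillOf a b E.1, isRowFill_fillOf E.2⟩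
  left_inv T := Subtype.ext ((isThrOf_fillOf (isThr_thrOf hba)).eq_fill
    (isThrOf_thrOf hba T.2) (isRowFill_fillOf (isThr_thrOf hba)) T.2)
  right_inv E := Subtype.ext ((isThrOf_thrOf hba (isRowFill_fillOf E.2)).eq
    (isThrOf_fillOf E.2))

theorem IsThrOf.mem_Ico_iff (h : IsThrOf a b T E) (i j k : ℕ) :
    j ∈ Ico (E i k) (E i (k + 1)) ↔ b i ≤ j ∧ j < a i ∧ T i j = k := by
  rw [mem_Ico]
  have h1 := h.ge i k
  have h2 := h.le i (k + 1)
  constructor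
  · rintro ⟨h3, h4⟩
    have h5 := h.spec i j k (by omega) (by omega)
    have h6 := h.spec i j (k + 1) (by omega) (by omega)
    omega
  · rintro ⟨h3, h4, h7⟩
    have h5 := h.spec i j k (by omega) (by omega)
    have h6 := h.spec i j (k + 1) (by omega) (by omega)
    omega

theorem IsThrOf.skewContent_eq (h : IsThrOf a b T E) {K : ℕ} (hK : ∀ i, K ≤ i → a i = 0) (k : ℕ) :
    skewContent a b T k = ∑ i ∈ range K, (E i (k + 1) - E i k) := by
  unfold skewContent
  rw [card_cells K fun i => Ico (E i k) (E i (k + 1))]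
  · simp
  · intro i j
    rw [h.mem_Ico_iff]
    refine ⟨fun hc => ⟨?_, hc⟩, fun hc => hc.2⟩
    by_contra hi
    have h1 := hK i (by omega)
    have h2 : j < a i := hc.2.1
    omega

theorem IsThrOf.lrCount_eq (h : IsThrOf a b T E) (i j k : ℕ) :
    lrCount a b T i j k
      = ∑ i' ∈ range i, (E i' (k + 1) - E i' k) + (E i (k + 1) - max j (E i k)) := by
  unfold lrCount
  rw [card_cells (i + 1) fun i' => (Ico (E i' k) (E i' (k + 1))).filter
    fun j' => i' < i ∨ j ≤ j', sum_range_succ]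
  · congr 1
    · refine sum_congr rfl fun i' hi' => ?_
      rw [filter_true_of_mem fun _ _ => Or.inl (mem_range.1 hi'), Nat.card_Ico]
    · rw [← Nat.card_Ico]
      congr 1
      ext j'
      simp only [mem_filter, mem_Ico]
      omega
  · intro i' j'
    rw [mem_filter, h.mem_Ico_iff]
    simp only
    constructor
    · rintro ⟨h1, h2⟩
      exact ⟨by omega, h2, by omega⟩
    · rintro ⟨h1, h2, h3⟩
      exact ⟨by omega, h2⟩

theorem skewSize_eq (a b : ℕ → ℕ) {K : ℕ} (hK : ∀ i, K ≤ i → a i = 0) :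
    skewSize a b = ∑ i ∈ range K, (a i - b i) := by
  unfold skewSize
  rw [card_cells K fun i => Ico (b i) (a i)]
  · simp
  · intro i j
    rw [mem_Ico]
    refine ⟨fun hc => ⟨?_, hc⟩, fun hc => hc.2⟩
    by_contra hi
    have h1 := hK i (by omega)
    have h2 : j < a i := hc.2
    omega

theorem IsThrOf.col_strict_iff (h : IsThrOf a b T E) (ha : Antitone a) (hb : Antitone b) :
    (∀ i₁ i₂ j, i₁ < i₂ → b i₁ ≤ j → j < a i₁ → b i₂ ≤ j → j < a i₂ → T i₁ j < T i₂ j)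
      ↔ ∀ i k, E (i + 1) (k + 1) ≤ E i k := by
  constructor
  · intro hc i k
    by_contra hlt
    have h1 := h.ge i k
    have h2 := h.le (i + 1) (k + 1)
    have h3 : b (i + 1) ≤ b i := hb (Nat.le_succ i)
    have h4 : a (i + 1) ≤ a i := ha (Nat.le_succ i)
    have h5 := hc i (i + 1) (E i k) (by omega) (by omega) (by omega) (by omega) (by omega)
    have h6 := h.spec i (E i k) k (by omega) (by omega)
    have h7 := h.spec (i + 1) (E i k) (k + 1) (by omega) (by omega)
    omega
  · intro hc i₁ i₂ j hi hb1 ha1 _ ha2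
    have key : ∀ d, j < a (i₁ + d + 1) → T i₁ j < T (i₁ + d + 1) j := by
      intro d
      induction d with
      | zero =>
        intro hj
        have h3 : b (i₁ + 0 + 1) ≤ b i₁ := hb (by omega)
        have h1 := hc (i₁ + 0) (T (i₁ + 0 + 1) j)
        have h2 := h.spec i₁ j (T (i₁ + 0 + 1) j) hb1 ha1
        have h4 := h.spec (i₁ + 0 + 1) j (T (i₁ + 0 + 1) j + 1) (by omega) hj
        simp only [Nat.add_zero] at *
        omega
      | succ d ih =>
        intro hj
        have h3 : b (i₁ + (d + 1)) ≤ b i₁ := hb (by omega)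
        have h3' : b (i₁ + (d + 1) + 1) ≤ b i₁ := hb (by omega)
        have h5 : a (i₁ + (d + 1) + 1) ≤ a (i₁ + (d + 1)) := ha (by omega)
        have h6 := ih (by rw [show i₁ + d + 1 = i₁ + (d + 1) by omega]; omega)
        rw [show i₁ + d + 1 = i₁ + (d + 1) by omega] at h6
        have h1 := hc (i₁ + (d + 1)) (T (i₁ + (d + 1) + 1) j)
        have h2 := h.spec (i₁ + (d + 1)) j (T (i₁ + (d + 1) + 1) j) (by omega) (by omega)
        have h4 := h.spec (i₁ + (d + 1) + 1) j (T (i₁ + (d + 1) + 1) j + 1) (by omega) hj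
        omega
    have := key (i₂ - i₁ - 1)
    rw [show i₁ + (i₂ - i₁ - 1) + 1 = i₂ by omega] at this
    exact this ha2

theorem nonempty_equiv_of_thr {a b : ℕ → ℕ} (hba : ∀ i, b i ≤ a i) {P Q : (ℕ → ℕ → ℕ) → Prop}
    (h : ∀ T E, IsRowFill a b T → IsThr a b E → IsThrOf a b T E → (P T ↔ Q E)) :
    Nonempty ({T // IsRowFill a b T ∧ P T} ≃ {E // IsThr a b E ∧ Q E}) := by
  refine ⟨((Equiv.subtypeSubtypeEquivSubtypeInter _ _).symm.trans
    ((thrEquiv a b hba).subtypeEquiv (p := fun T => P T.1) (q := fun E => Q E.1) ?_)).trans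
    (Equiv.subtypeSubtypeEquivSubtypeInter _ _)⟩
  exact fun T => h T.1 _ T.2 (thrEquiv a b hba T).2 (isThrOf_thrOf hba T.2)

theorem isSSYT_iff {a : ℕ → ℕ} (ha : Antitone a) {T : ℕ → ℕ → ℕ} : IsSSYT a T ↔ IsRowFill a (fun _ => 0) T ∧
    ∀ i₁ i₂ j, i₁ < i₂ → 0 ≤ j → j < a i₁ → 0 ≤ j → j < a i₂ → T i₁ j < T i₂ j := by
  constructor
  · rintro ⟨h1, h2, h3⟩
    exact ⟨⟨fun i j h => h1 i j (by simpa using h), fun i j₁ j₂ _ => h2 i j₁ j₂⟩,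
      fun i₁ i₂ j hi _ _ _ hj => h3 i₁ i₂ j hi hj⟩
  · rintro ⟨⟨h1, h2⟩, h3⟩
    refine ⟨fun i j h => h1 i j (by simpa using h), fun i j₁ j₂ => h2 i j₁ j₂ (Nat.zero_le _),
      fun i₁ i₂ j hi hj => h3 i₁ i₂ j hi (Nat.zero_le _) (hj.trans_le (ha hi.le)) (Nat.zero_le _) hj⟩

theorem eq_top_of_step {f : ℕ → ℕ} {K c : ℕ} (hf : ∀ k, K ≤ k → f (k + 1) = f k)
    (ht : ∃ N, ∀ k, N ≤ k → f k = c) {k : ℕ} (hk : K ≤ k) : f k = c := by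
  obtain ⟨N, hN⟩ := ht
  have : ∀ d, f (k + d) = f k := by
    intro d
    induction d with
    | zero => rfl
    | succ d ih => rw [← ih, ← hf (k + d) (by omega)]; rfl
  rw [← this N, hN _ (by omega)]

theorem IsGT.weight_eq_sum {p : ℕ} {a : ℕ → ℕ} {g : ℕ → ℕ → ℕ} (h : IsGT p a g) (k : ℕ) :
    gtWeight p g k = ∑ i ∈ range p, (g (k + 1) i - g k i) := by
  rw [sum_tsub_distrib _ fun i _ => h.mono k i]
  rfl

theorem isThr_iff_isGT {p K : ℕ} {a : ℕ → ℕ} (hK : ∀ i, K ≤ i → a i = 0) (l : Fin p → ℕ)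
    (g : ℕ → ℕ → ℕ) :
    (IsThr a (fun _ => 0) (fun i k => g k i) ∧ (∀ i k, g (k + 1) (i + 1) ≤ g k i) ∧
      ∀ k, ∑ i ∈ range K, (g (k + 1) i - g k i) = extc l k)
    ↔ IsGT p a g ∧ ∀ k : Fin p, gtWeight p g k = l k := by
  have hsum : IsGT p a g → ∀ k,
      gtWeight p g k = ∑ i ∈ range K, (g (k + 1) i - g k i) := fun hg k => by
    rw [hg.weight_eq_sum]
    refine sum_range_eq_of_support (fun i hi => ?_) fun i hi => ?_
    · have := hg.le_top (k + 1) i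
      rw [hg.top_eq_zero hi] at this
      omega
    · have := hg.le_top (k + 1) i
      rw [hK i hi] at this
      omega
  constructor
  · rintro ⟨h1, h2, h3⟩
    have hg : IsGT p a g := by
      refine ⟨h1.zero, fun k i hk => ?_, fun k i => h1.mono i k, fun k i => h2 i k⟩
      rcases lt_or_ge i K with hi | hi
      · refine eq_top_of_step (f := fun k => g k i) (fun k hk => ?_) (h1.top i) hk
        have h4 := h3 k
        rw [extc_of_ge l hk, sum_eq_zero_iff] at h4
        have h5 := h4 i (mem_range.2 hi)
        have h6 : g k i ≤ g (k + 1) i := h1.mono i k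
        omega
      · have : g k i ≤ a i := h1.le i k
        rw [hK i hi] at this ⊢
        omega
    exact ⟨hg, fun k => by rw [hsum hg, h3, extc_of_lt]⟩
  · rintro ⟨hg, hw⟩
    refine ⟨⟨hg.zero, fun i k => hg.mono k i, fun i => ⟨p, fun k hk => hg.top k i hk⟩⟩,
      fun i k => hg.inter k i, fun k => ?_⟩
    rw [← hsum hg]
    rcases lt_or_ge k p with hk | hk
    · rw [extc_of_lt l ⟨k, hk⟩]
      exact hw ⟨k, hk⟩
    · rw [extc_of_ge l hk, hg.weight_eq_zero hk]

/-- Semistandard tableaux correspond to Gelfand–Tsetlin patterns. -/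
theorem nonempty_ssyt_equiv {p K : ℕ} {a : ℕ → ℕ} (ha : Antitone a) (hK : ∀ i, K ≤ i → a i = 0)
    (l : Fin p → ℕ) :
    Nonempty ({T : ℕ → ℕ → ℕ // IsSSYT a T ∧ ∀ k, skewContent a (fun _ => 0) T k = extc l k}
      ≃ {g // IsGT p a g ∧ ∀ k : Fin p, gtWeight p g k = l k}) := by
  simp only [isSSYT_iff ha, and_assoc]
  refine (nonempty_equiv_of_thr (fun i => Nat.zero_le _) (Q := fun E =>
    (∀ i k, E (i + 1) (k + 1) ≤ E i k) ∧
      ∀ k, ∑ i ∈ range K, (E i (k + 1) - E i k) = extc l k) ?_).map fun e => e.trans ?_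
  · intro T E _ _ h
    refine and_congr (h.col_strict_iff ha antitone_const) (forall_congr' fun k => ?_)
    rw [h.skewContent_eq hK]
  · refine (Equiv.piComm fun _ _ => ℕ).subtypeEquiv fun E => ?_
    exact isThr_iff_isGT hK l fun k i => E i k

/-- The pattern of a threshold function. -/
def gtOf (E : ℕ → ℕ → ℕ) (k i : ℕ) : ℕ := ∑ j ∈ range k, (E j (i + 1) - E j i)

/-- The threshold function of a pattern. -/
def thrOfGT (lam : ℕ → ℕ) (g : ℕ → ℕ → ℕ) (k i : ℕ) : ℕ :=
  lam k + (gtSum g (k + 1) i - gtSum g k i)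

theorem gtOf_succ (E : ℕ → ℕ → ℕ) (k i : ℕ) :
    gtOf E (k + 1) i = gtOf E k i + (E k (i + 1) - E k i) := sum_range_succ _ _

theorem gtSum_gtOf {κ lam : ℕ → ℕ} {E : ℕ → ℕ → ℕ} (h : IsThr κ lam E) (k i : ℕ) :
    lam k + gtSum (gtOf E) (k + 1) i = gtSum (gtOf E) k i + E k i := by
  induction i with
  | zero => rw [gtSum_zero, gtSum_zero, h.zero]; omega
  | succ i ih =>
    rw [gtSum_succ, gtSum_succ, gtOf_succ]
    have := h.mono k i
    omega

theorem thrOfGT_gtOf {κ lam : ℕ → ℕ} {E : ℕ → ℕ → ℕ} (h : IsThr κ lam E) :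
    thrOfGT lam (gtOf E) = E := by
  funext k i
  have h1 := gtSum_gtOf h k i
  have h2 := h.ge k i
  unfold thrOfGT
  omega

theorem thrOfGT_succ {p : ℕ} {a lam : ℕ → ℕ} {g : ℕ → ℕ → ℕ} (h : IsGT p a g) (k i : ℕ) :
    thrOfGT lam g k (i + 1) = thrOfGT lam g k i + (g (k + 1) i - g k i) := by
  unfold thrOfGT
  have h1 := h.gtSum_mono k i
  have h2 := h.mono k i
  rw [gtSum_succ, gtSum_succ]
  omega

theorem gtOf_thrOfGT {p : ℕ} {a lam : ℕ → ℕ} {g : ℕ → ℕ → ℕ} (h : IsGT p a g) :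
    gtOf (thrOfGT lam g) = g := by
  funext k i
  induction k with
  | zero => simp [gtOf, h.zero]
  | succ k ih =>
    have := h.mono k i
    rw [gtOf_succ, ih, thrOfGT_succ h]
    omega

/-- The conditions on threshold functions defining Littlewood–Richardson tableaux. -/
structure IsLRThr (p : ℕ) (κ lam mu : ℕ → ℕ) (E : ℕ → ℕ → ℕ) : Prop where
  thr : IsThr κ lam E
  col : ∀ i k, E (i + 1) (k + 1) ≤ E i k
  lattice : ∀ i j k, gtOf E i (k + 1) + (E i (k + 2) - max j (E i (k + 1)))
    ≤ gtOf E i k + (E i (k + 1) - max j (E i k))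
  content : ∀ k, gtOf E p k = mu k

theorem IsLRThr.isGT {p : ℕ} {κ lam mu : ℕ → ℕ} {E : ℕ → ℕ → ℕ} (h : IsLRThr p κ lam mu E)
    (hκ : ∀ i, p ≤ i → κ i = 0) : IsGT p mu (gtOf E) := by
  refine ⟨fun i => by simp [gtOf], fun k i hk => ?_, fun k i => ?_, fun k i => ?_⟩
  · rw [← h.content]
    have h0 : ∀ j, p ≤ j → E j (i + 1) - E j i = 0 := fun j hj => by
      have := h.thr.le j (i + 1)
      rw [hκ j hj] at this
      omega
    exact sum_range_eq_of_support (fun j hj => h0 j (by omega)) h0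
  · rw [gtOf_succ]; omega
  · have := h.lattice k (E k (i + 1)) i
    have h2 := h.thr.mono k i
    rw [max_self, max_eq_left h2] at this
    rw [gtOf_succ]
    change gtOf E k (i + 1) + (E k (i + 2) - E k (i + 1)) ≤ _
    omega

theorem IsLRThr.good {p : ℕ} {κ lam mu : ℕ → ℕ} {E : ℕ → ℕ → ℕ} (h : IsLRThr p κ lam mu E) :
    GTGood p lam (gtOf E) := by
  intro k i _ hv
  unfold GTViol at hv
  have h1 := gtSum_gtOf h.thr k i
  have h2 := gtSum_gtOf h.thr (k + 1) (i + 1)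
  have h3 := h.col k i
  have h4 : gtSum (gtOf E) (k + 2) (i + 1) = gtSum (gtOf E) (k + 1 + 1) (i + 1) := rfl
  omega

theorem IsLRThr.weight {p : ℕ} {κ lam mu : ℕ → ℕ} {E : ℕ → ℕ → ℕ} (h : IsLRThr p κ lam mu E)
    (hκ : ∀ i, p ≤ i → κ i = 0) : (fun k => lam k + gtWeight p (gtOf E) k) = κ := by
  funext k
  have h1 := gtSum_gtOf h.thr k p
  have h2 := h.thr.ge k p
  have h3 := (h.isGT hκ).weight_add k
  have h4 : E k p = κ k := by
    rcases lt_or_ge k p with hk | hk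
    · refine eq_top_of_step (f := E k) (K := k + 1) (fun i hi => ?_) (h.thr.top k) hk
      have h5 := (h.isGT hκ).eq_zero hi
      rw [gtOf_succ] at h5
      have h6 := h.thr.mono k i
      omega
    · have := h.thr.le k p
      rw [hκ k hk] at this ⊢
      omega
  omega

theorem isLRThr_thrOfGT {p : ℕ} {κ lam mu : ℕ → ℕ} {g : ℕ → ℕ → ℕ} (h : IsGT p mu g)
    (hκ : ∀ i, p ≤ i → κ i = 0) (hg : GTGood p lam g)
    (hw : (fun k => lam k + gtWeight p g k) = κ) : IsLRThr p κ lam mu (thrOfGT lam g) := by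
  have ht : IsThr κ lam (thrOfGT lam g) := by
    refine ⟨fun i => by simp [thrOfGT, gtSum_zero], fun k i => ?_, fun k => ?_⟩
    · rw [thrOfGT_succ h]; omega
    · refine ⟨max p (k + 1), fun i hi => ?_⟩
      rw [← hw]
      simp only [thrOfGT]
      rcases lt_or_ge k p with hk | hk
      · rw [gtWeight, ← h.gtSum_stable (k := k + 1) (i := p) (j := i) (by omega) (by omega),
          ← h.gtSum_stable (k := k) (i := p) (j := i) (by omega) (by omega)]
      · have : gtSum g (k + 1) i = gtSum g k i := sum_congr rfl fun j _ => by
          rw [h.top k j hk, h.top (k + 1) j (by omega)]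
        rw [h.weight_eq_zero hk, this, Nat.sub_self]
  refine ⟨ht, fun k i => ?_, fun i j k => ?_, fun k => ?_⟩
  · rcases lt_or_ge (k + 1) p with hk | hk
    · have h1 := hg k i hk
      unfold GTViol at h1
      have h2 := h.gtSum_mono k i
      have h3 := h.gtSum_mono (k + 1) (i + 1)
      have h4 : gtSum g (k + 2) (i + 1) = gtSum g (k + 1 + 1) (i + 1) := rfl
      unfold thrOfGT
      omega
    · have := ht.le (k + 1) (i + 1)
      rw [hκ _ hk] at this
      omega
  · rw [gtOf_thrOfGT h]
    have h1 := thrOfGT_succ (lam := lam) h i (k + 1)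
    have h2 := h.inter i k
    have h3 := h.mono i (k + 1)
    have h4 : thrOfGT lam g i (k + 2) = thrOfGT lam g i (k + 1 + 1) := rfl
    omega
  · rw [gtOf_thrOfGT h]
    exact h.top _ _ le_rfl

/-- Littlewood–Richardson thresholds correspond to good patterns. -/
def lrThrEquiv {p : ℕ} {κ : ℕ → ℕ} (lam mu : ℕ → ℕ) (hκ : ∀ i, p ≤ i → κ i = 0) :
    {E // IsLRThr p κ lam mu E} ≃ {g : {g : ℕ → ℕ → ℕ // IsGT p mu g} //
      GTGood p lam g.1 ∧ (fun k => lam k + gtWeight p g.1 k) = κ} where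
  toFun E := ⟨⟨gtOf E.1, E.2.isGT hκ⟩, E.2.good, E.2.weight hκ⟩
  invFun g := ⟨thrOfGT lam g.1.1, isLRThr_thrOfGT g.1.2 hκ g.2.1 g.2.2⟩
  left_inv E := Subtype.ext (thrOfGT_gtOf E.2.thr)
  right_inv g := Subtype.ext (Subtype.ext (gtOf_thrOfGT g.1.2))

theorem isLR_iff_isLRThr {p : ℕ} {κ lam mu : ℕ → ℕ} {S E : ℕ → ℕ → ℕ}
    (hκ : ∀ i, p ≤ i → κ i = 0) (hκa : Antitone κ) (hlam : Antitone lam)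
    (hS : IsRowFill κ lam S) (hE : IsThr κ lam E) (h : IsThrOf κ lam S E) :
    (IsLR κ lam S ∧ ∀ k, skewContent κ lam S k = mu k) ↔ IsLRThr p κ lam mu E := by
  have h1 := h.col_strict_iff hκa hlam
  have h2 : (∀ i j k, lrCount κ lam S i j (k + 1) ≤ lrCount κ lam S i j k) ↔
      ∀ i j k, gtOf E i (k + 1) + (E i (k + 2) - max j (E i (k + 1)))
        ≤ gtOf E i k + (E i (k + 1) - max j (E i k)) := by
    refine forall_congr' fun i => forall_congr' fun j => forall_congr' fun k => ?_
    rw [h.lrCount_eq, h.lrCount_eq]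
    rfl
  have h3 : (∀ k, skewContent κ lam S k = mu k) ↔ ∀ k, gtOf E p k = mu k := by
    refine forall_congr' fun k => ?_
    rw [h.skewContent_eq hκ]
    rfl
  constructor
  · rintro ⟨⟨_, _, h4, h5⟩, h6⟩
    exact ⟨hE, h1.1 h4, h2.1 h5, h3.1 h6⟩
  · intro h4
    exact ⟨⟨hS.1, hS.2, h1.2 h4.col, h2.2 h4.lattice⟩, h3.2 h4.content⟩

theorem nonempty_lr_equiv {p : ℕ} {κ lam : ℕ → ℕ} (mu : ℕ → ℕ)
    (hκ : ∀ i, p ≤ i → κ i = 0) (hκa : Antitone κ) (hlam : Antitone lam) :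
    Nonempty ({S // (∀ i, lam i ≤ κ i) ∧ IsLR κ lam S ∧ ∀ k, skewContent κ lam S k = mu k}
      ≃ {g : {g : ℕ → ℕ → ℕ // IsGT p mu g} //
        GTGood p lam g.1 ∧ (fun k => lam k + gtWeight p g.1 k) = κ}) := by
  by_cases hle : ∀ i, lam i ≤ κ i
  · have h1 : ∀ S, ((∀ i, lam i ≤ κ i) ∧ IsLR κ lam S ∧ ∀ k, skewContent κ lam S k = mu k) ↔
        IsRowFill κ lam S ∧ IsLR κ lam S ∧ ∀ k, skewContent κ lam S k = mu k := fun S =>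
      ⟨fun h => ⟨⟨h.2.1.1, h.2.1.2.1⟩, h.2⟩, fun h => ⟨hle, h.2⟩⟩
    have h2 : ∀ E, (IsThr κ lam E ∧ IsLRThr p κ lam mu E) ↔ IsLRThr p κ lam mu E := fun E =>
      ⟨fun h => h.2, fun h => ⟨h.thr, h⟩⟩
    obtain ⟨e⟩ := nonempty_equiv_of_thr hle fun S E hS hE h =>
      isLR_iff_isLRThr (mu := mu) hκ hκa hlam hS hE h
    exact ⟨((Equiv.subtypeEquivRight h1).trans e).trans
      ((Equiv.subtypeEquivRight h2).trans (lrThrEquiv lam mu hκ))⟩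
  · have h1 : IsEmpty {S // (∀ i, lam i ≤ κ i) ∧ IsLR κ lam S ∧
        ∀ k, skewContent κ lam S k = mu k} := ⟨fun S => hle S.2.1⟩
    have h2 : IsEmpty {g : {g : ℕ → ℕ → ℕ // IsGT p mu g} //
        GTGood p lam g.1 ∧ (fun k => lam k + gtWeight p g.1 k) = κ} :=
      ⟨fun g => hle fun i => by rw [← g.2.2]; exact Nat.le_add_right _ _⟩
    exact ⟨Equiv.equivOfIsEmpty _ _⟩

/-- Littlewood–Richardson tableaux of shape `κ/lam` and content `mu`. -/
abbrev LRTab (lam mu κ : ℕ → ℕ) : Type :=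
  {S // (∀ i, lam i ≤ κ i) ∧ IsLR κ lam S ∧ ∀ k, skewContent κ lam S k = mu k}

/-- The Littlewood–Richardson coefficient. -/
def lrCoef (lam mu κ : ℕ → ℕ) : ℕ := Nat.card (LRTab lam mu κ)

theorem finite_lrTab {n : ℕ} (lam mu κ : PB n) : Finite (LRTab lam.1 mu.1 κ.1) := by
  obtain ⟨e⟩ := nonempty_lr_equiv mu.1 κ.2.2.1 κ.2.1 lam.2.1
  exact Finite.of_equiv _ e.symm

theorem schur_mul_schur_lrCoef {R : Type*} [CommRing R] {p n : ℕ} (x : Fin p → R)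
    (lam mu : PB n) (hn : lam.size + mu.size ≤ n) :
    schur x lam.1 * schur x mu.1 = ∑ κ : PB n, (lrCoef lam.1 mu.1 κ.1 : R) * schur x κ.1 := by
  by_cases hp : ∀ i, p ≤ i → lam.1 i = 0
  · rw [schur_mul_schur_PB x lam mu hp hn]
    refine sum_congr rfl fun κ _ => ?_
    by_cases hκ : ∀ i, p ≤ i → κ.1 i = 0
    · obtain ⟨e⟩ := nonempty_lr_equiv mu.1 hκ κ.2.1 lam.2.1
      rw [lrCoef, Nat.card_congr e]
    · rw [schur_eq_zero x hκ, mul_zero, mul_zero]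
  · rw [schur_eq_zero x hp, zero_mul]
    refine (sum_eq_zero fun κ _ => ?_).symm
    by_cases hκ : ∀ i, p ≤ i → κ.1 i = 0
    · have : IsEmpty (LRTab lam.1 mu.1 κ.1) := ⟨fun S => hp fun i hi => by
        have := S.2.1 i
        rw [hκ i hi] at this
        omega⟩
      rw [lrCoef, Nat.card_of_isEmpty, Nat.cast_zero, zero_mul]
    · rw [schur_eq_zero x hκ, mul_zero]

theorem size_of_lrCoef_ne_zero {n : ℕ} {lam mu κ : PB n} (h : lrCoef lam.1 mu.1 κ.1 ≠ 0) :
    κ.size = lam.size + mu.size := by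
  obtain ⟨e⟩ := nonempty_lr_equiv mu.1 κ.2.2.1 κ.2.1 lam.2.1
  rw [lrCoef, Nat.card_congr e] at h
  obtain ⟨g⟩ := (Nat.card_ne_zero.1 h).1
  have : κ.size = ∑ i ∈ range n, (lam.1 i + gtWeight n g.1.1 i) :=
    sum_congr rfl fun i _ => (congrFun g.2.2 i).symm
  rw [this, sum_add_distrib, sum_gtWeight g.1.2]
  rfl

/-- The content of a Littlewood–Richardson tableau is a partition of its size. -/
theorem IsLR.content {n : ℕ} {lam κ : PB n} {S : ℕ → ℕ → ℕ} (hle : ∀ i, lam.1 i ≤ κ.1 i)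
    (h : IsLR κ.1 lam.1 S) : ∃ mu : PB n, mu.1 = skewContent κ.1 lam.1 S ∧
      mu.size = skewSize κ.1 lam.1 := by
  obtain ⟨e⟩ := nonempty_lr_equiv (skewContent κ.1 lam.1 S) κ.2.2.1 κ.2.1 lam.2.1
  obtain ⟨⟨g, hg⟩, _, hw⟩ := e ⟨S, hle, h, fun _ => rfl⟩
  have hs : ∑ i ∈ range n, skewContent κ.1 lam.1 S i = skewSize κ.1 lam.1 := by
    rw [skewSize_eq κ.1 lam.1 κ.2.2.1, ← sum_gtWeight hg]
    refine sum_congr rfl fun i _ => ?_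
    have : lam.1 i + gtWeight n g i = κ.1 i := congrFun hw i
    omega
  have hsize : skewSize κ.1 lam.1 ≤ n := by
    rw [skewSize_eq κ.1 lam.1 κ.2.2.1]
    exact (sum_le_sum fun i _ => Nat.sub_le _ _).trans κ.2.2.2
  exact ⟨⟨_, hg.antitone, fun i hi => hg.top_eq_zero hi, hs ▸ hsize⟩, rfl, hs⟩

theorem PB.lt_conjFun_iff {n : ℕ} (a : PB n) (i j : ℕ) : i < conjFun n a.1 j ↔ j < a.1 i := by
  unfold conjFun
  constructor
  · intro h
    by_contra hc
    have : (range n).filter (fun i => j < a.1 i) ⊆ range i := by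
      intro k hk
      rw [mem_filter] at hk
      rw [mem_range]
      by_contra hki
      have := a.2.1 (not_lt.1 hki)
      omega
    have := card_le_card this
    rw [card_range] at this
    omega
  · intro h
    have hin : i < n := by
      by_contra hc
      rw [a.2.2.1 i (by omega)] at h
      omega
    have : range (i + 1) ⊆ (range n).filter (fun i => j < a.1 i) := by
      intro k hk
      rw [mem_range] at hk
      rw [mem_filter, mem_range]
      exact ⟨by omega, h.trans_le (a.2.1 (by omega))⟩
    have := card_le_card this
    rw [card_range] at this
    omega

theorem PB.apply_le {n : ℕ} (a : PB n) (i : ℕ) : a.1 i ≤ n := by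
  rcases lt_or_ge i n with h | h
  · exact (single_le_sum (fun _ _ => Nat.zero_le _) (mem_range.2 h)).trans a.2.2.2
  · rw [a.2.2.1 i h]
    exact Nat.zero_le _

theorem PB.sum_conjFun {n : ℕ} (a : PB n) : ∑ j ∈ range n, conjFun n a.1 j = a.size := by
  unfold conjFun PB.size
  simp only [card_filter]
  rw [sum_comm]
  refine sum_congr rfl fun i _ => ?_
  rw [← card_filter]
  have : (range n).filter (fun j => j < a.1 i) = range (a.1 i) := by
    ext j
    have := a.apply_le i
    simp only [mem_filter, mem_range]
    omega
  rw [this, card_range]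

/-- The conjugate partition. -/
def PB.conj {n : ℕ} (a : PB n) : PB n :=
  ⟨conjFun n a.1, fun i j hij => le_of_forall_lt fun k hk => by
      rw [a.lt_conjFun_iff] at hk ⊢
      omega,
    fun i hi => by
      by_contra h
      have h1 := (a.lt_conjFun_iff 0 i).1 (by omega)
      have := a.apply_le 0
      omega,
    by rw [a.sum_conjFun]; exact a.2.2.2⟩

theorem PB.lt_conj_iff {n : ℕ} (a : PB n) (i j : ℕ) : i < a.conj.1 j ↔ j < a.1 i :=
  a.lt_conjFun_iff i j

theorem PB.conj_conj {n : ℕ} (a : PB n) : a.conj.conj = a :=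
  Subtype.ext (funext fun i => eq_of_forall_lt_iff fun j => by
    rw [PB.lt_conj_iff, PB.lt_conj_iff])

theorem PB.size_conj {n : ℕ} (a : PB n) : a.conj.size = a.size := a.sum_conjFun

theorem PB.conj_empty (n : ℕ) : (PB.empty n).conj = PB.empty n :=
  Subtype.ext (funext fun i => eq_of_forall_lt_iff fun j => by
    rw [PB.lt_conj_iff]
    simp [PB.empty])

/-- Chains of vertical strips from the empty partition to `ρ`. -/
def IsVChain {n q : ℕ} (ρ : PB n) (c : Fin (q + 1) → PB n) : Prop :=
  c 0 = PB.empty n ∧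
    (∀ (k : Fin q) i, (c k.castSucc).1 i ≤ (c k.succ).1 i ∧
      (c k.succ).1 i ≤ (c k.castSucc).1 i + 1) ∧
    c (Fin.last q) = ρ

theorem IsVChain.isGT {n q : ℕ} {ρ : PB n} {c : Fin (q + 1) → PB n} (h : IsVChain ρ c) :
    IsGT q ρ.conj.1 fun k => (c ⟨min k q, by omega⟩).conj.1 := by
  have key : ∀ k, k < q → ∃ k' : Fin q, (⟨min k q, by omega⟩ : Fin (q + 1)) = k'.castSucc ∧
      (⟨min (k + 1) q, by omega⟩ : Fin (q + 1)) = k'.succ := fun k hk =>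
    ⟨⟨k, hk⟩, Fin.ext (by simp; omega), Fin.ext (by simp; omega)⟩
  have key2 : ∀ k, q ≤ k → (⟨min k q, by omega⟩ : Fin (q + 1)) = Fin.last q := fun k hk =>
    Fin.ext (by simp; omega)
  refine ⟨fun i => ?_, fun k i hk => ?_, fun k i => ?_, fun k i => ?_⟩
  · have : (⟨min 0 q, by omega⟩ : Fin (q + 1)) = 0 := Fin.ext (by simp)
    rw [this, h.1, PB.conj_empty]
    rfl
  · rw [key2 k hk, h.2.2]
  · rcases lt_or_ge k q with hk | hk
    · obtain ⟨k', h1, h2⟩ := key k hk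
      rw [h1, h2]
      refine le_of_forall_lt fun j hj => ?_
      rw [PB.lt_conj_iff] at hj ⊢
      exact hj.trans_le (h.2.1 k' j).1
    · rw [key2 k hk, key2 (k + 1) (by omega)]
  · rcases lt_or_ge k q with hk | hk
    · obtain ⟨k', h1, h2⟩ := key k hk
      rw [h1, h2]
      refine le_of_forall_lt fun j hj => ?_
      rw [PB.lt_conj_iff] at hj ⊢
      have := (h.2.1 k' j).2
      omega
    · rw [key2 k hk, key2 (k + 1) (by omega)]
      exact (PB.conj _).2.1 (Nat.le_succ i)

/-- A level of a pattern as a bounded partition. -/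
def IsGT.level {n q : ℕ} {ρ : PB n} {g : ℕ → ℕ → ℕ} (h : IsGT q ρ.1 g) (k : ℕ) : PB n :=
  ⟨g k, h.level_antitone k, fun i hi => Nat.le_zero.1 ((h.le_top k i).trans (ρ.2.2.1 i hi).le),
    (sum_le_sum fun i _ => h.le_top k i).trans ρ.2.2.2⟩

theorem IsGT.isVChain {n q : ℕ} {ρ : PB n} {g : ℕ → ℕ → ℕ} (h : IsGT q ρ.conj.1 g) :
    IsVChain ρ fun k : Fin (q + 1) => (h.level k).conj := by
  refine ⟨?_, fun k i => ⟨?_, ?_⟩, ?_⟩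
  · have : h.level ((0 : Fin (q + 1)) : ℕ) = PB.empty n := Subtype.ext (funext fun i => h.zero i)
    change (h.level _).conj = _
    rw [this, PB.conj_empty]
  · refine le_of_forall_lt fun j hj => ?_
    rw [PB.lt_conj_iff] at hj ⊢
    exact hj.trans_le (h.mono k j)
  · refine le_of_forall_lt fun j hj => ?_
    rw [PB.lt_conj_iff] at hj
    cases j with
    | zero => omega
    | succ j =>
      have : j < (h.level k).conj.1 i := by
        rw [PB.lt_conj_iff]
        exact hj.trans_le (h.inter k j)
      exact Nat.succ_lt_succ this
  · have : h.level ((Fin.last q : Fin (q + 1)) : ℕ) = ρ.conj :=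
      Subtype.ext (funext fun i => h.top q i le_rfl)
    change (h.level _).conj = _
    rw [this, PB.conj_conj]

/-- Chains of vertical strips are the same as patterns of conjugate shape. -/
def vChainEquiv {n q : ℕ} (ρ : PB n) :
    {c : Fin (q + 1) → PB n // IsVChain ρ c} ≃ {g : ℕ → ℕ → ℕ // IsGT q ρ.conj.1 g} where
  toFun c := ⟨_, c.2.isGT⟩
  invFun g := ⟨_, g.2.isVChain⟩
  left_inv c := by
    refine Subtype.ext (funext fun k => ?_)
    have e : (⟨min (k : ℕ) q, by omega⟩ : Fin (q + 1)) = k := Fin.ext (by simp; omega)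
    have : (c.2.isGT).level k = (c.1 k).conj := Subtype.ext (by
      change (c.1 ⟨min (k : ℕ) q, _⟩).conj.1 = _
      rw [e])
    change ((c.2.isGT).level k).conj = _
    rw [this, PB.conj_conj]
  right_inv g := by
    refine Subtype.ext (funext fun k => ?_)
    change (g.2.level (min k q)).conj.conj.1 = g.1 k
    rw [PB.conj_conj]
    funext i
    change g.1 (min k q) i = g.1 k i
    rcases le_total k q with h | h
    · rw [min_eq_left h]
    · rw [min_eq_right h, g.2.top q i le_rfl, g.2.top k i h]

theorem IsGT.size_level {n q : ℕ} {ρ : PB n} {g : ℕ → ℕ → ℕ} (h : IsGT q ρ.1 g) (k : ℕ) :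
    (h.level k).size = gtSum g k q := by
  refine PB.size_eq _ (m := q) fun i hi => ?_
  exact Nat.le_zero.1 ((h.le_top k i).trans (h.top_eq_zero hi).le)

theorem vChainEquiv_weight {n q : ℕ} (ρ : PB n) (c : {c : Fin (q + 1) → PB n // IsVChain ρ c})
    (k : Fin q) : (c.1 k.succ).size =
      (c.1 k.castSucc).size + gtWeight q (vChainEquiv ρ c).1 k := by
  obtain ⟨g, rfl⟩ := (vChainEquiv ρ).symm.surjective c
  rw [Equiv.apply_symm_apply]
  change (g.2.level (k + 1)).conj.size = (g.2.level k).conj.size + _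
  rw [PB.size_conj, PB.size_conj, g.2.size_level, g.2.size_level, g.2.weight_add]

theorem eq_add_sum_of_succ {q : ℕ} (f : Fin (q + 1) → ℕ) (b : Fin q → ℕ)
    (h : ∀ k : Fin q, f k.succ = f k.castSucc + b k) : f (Fin.last q) = f 0 + ∑ k, b k := by
  induction q with
  | zero => simp
  | succ q ih =>
    have := ih (fun k => f k.castSucc) (fun k => b k.castSucc) fun k => h k.castSucc
    rw [Fin.sum_univ_castSucc, ← Fin.succ_last, h, this]
    simp [add_assoc]

/-- The generating function of binary matrices with `d` ones. -/
def binGen {R : Type*} [CommRing R] {p q : ℕ} (x : Fin p → R) (y : Fin q → R) (d : ℕ) : R :=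
  ∑ A : {A : Fin q → Fin p → Fin 2 // ∑ j, ∑ i, (A j i : ℕ) = d},
    ∏ j, ∏ i, (x i * y j) ^ (A.1 j i : ℕ)

theorem binGen_eq_sum_elemSym {R : Type*} [CommRing R] {p q : ℕ} (x : Fin p → R) (y : Fin q → R)
    (d : ℕ) : binGen x y d
      = ∑ b ∈ piAntidiag univ d, ∏ j, (elemSym x (b j) * y j ^ b j) := by
  have h1 : binGen x y d = ∑ A : Fin q → Fin p → Fin 2 with ∑ j, ∑ i, (A j i : ℕ) = d,
      ∏ j, ∏ i, (x i * y j) ^ (A j i : ℕ) := by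
    unfold binGen
    symm
    exact sum_subtype _ (fun _ => by simp) fun A : Fin q → Fin p → Fin 2 =>
      ∏ j, ∏ i, (x i * y j) ^ (A j i : ℕ)
  rw [h1, ← sum_fiberwise_of_maps_to (t := piAntidiag univ d)
    (g := fun (A : Fin q → Fin p → Fin 2) j => ∑ i, (A j i : ℕ))]
  · refine sum_congr rfl fun b hb => ?_
    have h2 : ∀ j, elemSym x (b j) * y j ^ b j = ∑ v : Fin p → Fin 2 with ∑ i, (v i : ℕ) = b j,
        ∏ i, (x i * y j) ^ (v i : ℕ) := by
      intro j
      have : elemSym x (b j) = ∑ v : Fin p → Fin 2 with ∑ i, (v i : ℕ) = b j,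
          ∏ i, x i ^ (v i : ℕ) := by
        unfold elemSym
        symm
        exact sum_subtype _ (fun _ => by simp) fun v : Fin p → Fin 2 => ∏ i, x i ^ (v i : ℕ)
      rw [this, sum_mul]
      refine sum_congr rfl fun v hv => ?_
      simp only [mul_pow, prod_mul_distrib]
      rw [prod_pow_eq_pow_sum, (mem_filter.1 hv).2]
    rw [prod_congr rfl fun j _ => h2 j, prod_univ_sum]
    refine sum_congr ?_ fun _ _ => rfl
    ext A
    simp only [mem_filter, mem_univ, true_and, Fintype.mem_piFinset, funext_iff]
    refine ⟨fun h => h.2, fun h => ⟨?_, h⟩⟩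
    rw [sum_congr rfl fun j _ => h j]
    exact (mem_piAntidiag.1 hb).1
  · intro A hA
    simpa using hA

theorem prod_elemSym_eq_sum_chain {R : Type*} [CommRing R] {n p q : ℕ} (x : Fin p → R)
    (y : Fin q → R) (b : Fin q → ℕ) (hb : ∑ j, b j ≤ n) :
    ∏ j, (elemSym x (b j) * y j ^ b j) = ∑ c : Fin (q + 1) → PB n,
      if c 0 = PB.empty n ∧ ∀ k : Fin q, VStrip (b k) (c k.castSucc) (c k.succ) then
        (∏ k, y k ^ b k) * schur x (c (Fin.last q)).1 else 0 := by
  have := mul_prod_eq_sum_chain (fun κ : PB n => schur x κ.1) PB.size n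
    (fun j => elemSym x (b j) * y j ^ b j)
    (fun k u v => if VStrip (b k) u v then y k ^ b k else 0) b
    (fun k u v h => by
      by_contra hc
      exact h (if_neg fun hV => hc hV.2))
    (fun k u hu => by
      rw [← mul_assoc, schur_mul_elemSym_PB x u (b k) hu, sum_mul]
      refine sum_congr rfl fun v _ => ?_
      split_ifs <;> ring) (PB.empty n) (by rw [PB.size_empty]; omega)
  have h1 : schur x (PB.empty n).1 = 1 := schur_zero x
  rw [h1, one_mul] at this
  rw [this]
  refine sum_congr rfl fun c _ => ?_
  by_cases h0 : c 0 = PB.empty n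
  · rw [if_pos h0]
    by_cases hV : ∀ k : Fin q, VStrip (b k) (c k.castSucc) (c k.succ)
    · rw [if_pos ⟨h0, hV⟩, prod_congr rfl fun k _ => if_pos (hV k)]
    · rw [if_neg fun h => hV h.2]
      push Not at hV
      obtain ⟨k, hk⟩ := hV
      rw [prod_eq_zero (mem_univ k) (if_neg hk), zero_mul]
  · rw [if_neg h0, if_neg fun h => h0 h.1]

theorem sum_vStrip_eq {R : Type*} [CommRing R] {n q d : ℕ} (y : Fin q → R)
    (c : Fin (q + 1) → PB n) (t : R) :
    (∑ b ∈ piAntidiag (univ : Finset (Fin q)) d,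
      if c 0 = PB.empty n ∧ ∀ k : Fin q, VStrip (b k) (c k.castSucc) (c k.succ) then
        (∏ k, y k ^ b k) * t else 0) =
      if IsVChain (c (Fin.last q)) c ∧ (c (Fin.last q)).size = d then
        (∏ k : Fin q, y k ^ ((c k.succ).size - (c k.castSucc).size)) * t else 0 := by
  split_ifs with h
  · obtain ⟨hc, hd⟩ := h
    have hw := vChainEquiv_weight _ ⟨c, hc⟩
    set w := gtWeight q (vChainEquiv (c (Fin.last q)) ⟨c, hc⟩).1
    change ∀ k : Fin q, (c k.succ).size = (c k.castSucc).size + w k at hw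
    have hs := eq_add_sum_of_succ (fun k => (c k).size) (fun k => w k) hw
    rw [hc.1, PB.size_empty, hd, zero_add] at hs
    rw [sum_eq_single (fun k : Fin q => w k)]
    · rw [if_pos ⟨hc.1, fun k => ⟨hc.2.1 k, hw k⟩⟩]
      congr 1
      refine prod_congr rfl fun k _ => ?_
      rw [hw k, Nat.add_sub_cancel_left]
    · intro b _ hb
      refine if_neg fun h => hb (funext fun k => ?_)
      have := (h.2 k).2
      have := hw k
      omega
    · intro h
      exact absurd (mem_piAntidiag.2 ⟨hs.symm, by simp⟩) h
  · refine sum_eq_zero fun b hb => if_neg fun hV => h ⟨⟨hV.1, fun k => (hV.2 k).1, rfl⟩, ?_⟩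
    have hs := eq_add_sum_of_succ (fun k => (c k).size) b fun k => (hV.2 k).2
    rw [hV.1, PB.size_empty, zero_add, (mem_piAntidiag.1 hb).1] at hs
    exact hs

/-- The dual Cauchy identity in degree `d`. -/
theorem binGen_eq_sum_schur {R : Type*} [CommRing R] {n p q d : ℕ} (hd : d ≤ n) (x : Fin p → R)
    (y : Fin q → R) : binGen x y d
      = ∑ ρ : PB n, if ρ.size = d then schur x ρ.1 * schur y ρ.conj.1 else 0 := by
  rw [binGen_eq_sum_elemSym, sum_congr rfl fun b hb => prod_elemSym_eq_sum_chain (n := n) x y b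
    ((mem_piAntidiag.1 hb).1.trans_le hd), sum_comm, sum_congr rfl fun c _ => sum_vStrip_eq y c _]
  have h1 : ∀ c : Fin (q + 1) → PB n,
      (if IsVChain (c (Fin.last q)) c ∧ (c (Fin.last q)).size = d then
        (∏ k : Fin q, y k ^ ((c k.succ).size - (c k.castSucc).size))
          * schur x (c (Fin.last q)).1 else 0) =
      ∑ ρ : PB n, if IsVChain ρ c ∧ ρ.size = d then
        (∏ k : Fin q, y k ^ ((c k.succ).size - (c k.castSucc).size)) * schur x ρ.1 else 0 := by
    intro c
    rw [Fintype.sum_eq_single (c (Fin.last q))]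
    intro ρ hρ
    exact if_neg fun h => hρ h.1.2.2.symm
  rw [sum_congr rfl fun c _ => h1 c, sum_comm]
  refine sum_congr rfl fun ρ _ => ?_
  split_ifs with h
  · simp only [h, and_true]
    rw [← sum_filter, ← sum_mul, mul_comm]
    congr 1
    rw [sum_subtype (p := IsVChain ρ) _ (by simp)]
    unfold schur
    refine Fintype.sum_equiv (vChainEquiv ρ) _ _ fun c => prod_congr rfl fun k _ => ?_
    rw [vChainEquiv_weight, Nat.add_sub_cancel_left]
  · simp [h]

/-- The coefficient of the Schur function of `α` in the product of those of the `ρ k`. -/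
def multCoef {n r : ℕ} (ρ : Fin r → PB n) (α : PB n) : ℕ :=
  ∑ c : {c : Fin (r + 1) → PB n // c 0 = PB.empty n ∧ c (Fin.last r) = α},
    ∏ k : Fin r, lrCoef (c.1 k.castSucc).1 (ρ k).1 (c.1 k.succ).1

theorem prod_schur_eq {R : Type*} [CommRing R] {n p r : ℕ} (x : Fin p → R) (ρ : Fin r → PB n)
    (hρ : ∑ k, (ρ k).size ≤ n) :
    ∏ k, schur x (ρ k).1 = ∑ α : PB n, (multCoef ρ α : R) * schur x α.1 := by
  have := mul_prod_eq_sum_chain (fun κ : PB n => schur x κ.1) PB.size n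
    (fun k => schur x (ρ k).1) (fun k u v => (lrCoef u.1 (ρ k).1 v.1 : R)) (fun k => (ρ k).size)
    (fun k u v h => size_of_lrCoef_ne_zero fun h0 => h (by rw [h0, Nat.cast_zero]))
    (fun k u hu => schur_mul_schur_lrCoef x u (ρ k) hu) (PB.empty n)
    (by rw [PB.size_empty]; omega)
  have h1 : schur x (PB.empty n).1 = 1 := schur_zero x
  rw [h1, one_mul] at this
  rw [this]
  have h2 : ∀ α : PB n, (multCoef ρ α : R) * schur x α.1 = ∑ c : Fin (r + 1) → PB n,
      if c 0 = PB.empty n ∧ c (Fin.last r) = α then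
        (∏ k : Fin r, (lrCoef (c k.castSucc).1 (ρ k).1 (c k.succ).1 : R)) * schur x α.1 else 0 := by
    intro α
    unfold multCoef
    rw [Nat.cast_sum, sum_mul, ← sum_filter]
    symm
    simp only [Nat.cast_prod]
    exact sum_subtype _ (fun _ => by simp) fun c : Fin (r + 1) → PB n =>
      (∏ k : Fin r, (lrCoef (c k.castSucc).1 (ρ k).1 (c k.succ).1 : R)) * schur x α.1
  rw [sum_congr rfl fun α _ => h2 α, sum_comm]
  refine sum_congr rfl fun c _ => ?_
  rw [Fintype.sum_eq_single (c (Fin.last r)) fun α hα => if_neg fun h => hα h.2.symm]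
  simp only [and_true]
  congr

theorem LRMultiF.chain_le {r : ℕ} {α : ℕ → ℕ} (M : LRMultiF r α) (k : Fin (r + 1)) (i : ℕ) :
    M.chain k i ≤ α i := by
  rw [← M.last i]
  have : Monotone fun k => M.chain k i := Fin.monotone_iff_le_succ.2 fun k => M.mono k i
  exact this (Fin.le_last k)

/-- The `k`-th partition of the chain of a multitableau. -/
def LRMultiF.chainPB {n r : ℕ} {α : PB n} (M : LRMultiF r α.1) (k : Fin (r + 1)) : PB n :=
  ⟨M.chain k, fun i j h => M.antitone k i j h,
    fun i hi => Nat.le_zero.1 ((M.chain_le k i).trans (α.2.2.1 i hi).le),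
    (sum_le_sum fun i _ => M.chain_le k i).trans α.2.2.2⟩

/-- Multitableaux of given contents as chains together with tableaux. -/
def multEquiv {n r : ℕ} (ρ : Fin r → PB n) (α : PB n) :
    {M : LRMultiF r α.1 // ∀ k, M.cont k = (ρ k).1} ≃
      Σ c : {c : Fin (r + 1) → PB n // c 0 = PB.empty n ∧ c (Fin.last r) = α},
        ∀ k : Fin r, LRTab (c.1 k.castSucc).1 (ρ k).1 (c.1 k.succ).1 where
  toFun M := ⟨⟨M.1.chainPB, Subtype.ext (funext M.1.zero), Subtype.ext (funext M.1.last)⟩,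
    fun k => ⟨M.1.T k, M.1.mono k, M.1.lr k, congrFun (M.2 k)⟩⟩
  invFun c := ⟨{
    chain := fun k => (c.1.1 k).1
    antitone := fun k _ _ h => (c.1.1 k).2.1 h
    zero := fun i => congrFun (congrArg Subtype.val c.1.2.1) i
    last := fun i => congrFun (congrArg Subtype.val c.1.2.2) i
    mono := fun k => (c.2 k).2.1
    T := fun k => (c.2 k).1
    lr := fun k => (c.2 k).2.2.1 }, fun k => funext (c.2 k).2.2.2⟩
  left_inv _ := rfl
  right_inv _ := rfl

theorem finite_mult {n r : ℕ} (ρ : Fin r → PB n) (α : PB n) :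
    Finite {M : LRMultiF r α.1 // ∀ k, M.cont k = (ρ k).1} := by
  have := fun lam mu κ : PB n => finite_lrTab lam mu κ
  exact Finite.of_equiv _ (multEquiv ρ α).symm

theorem card_mult {n r : ℕ} (ρ : Fin r → PB n) (α : PB n) :
    Nat.card {M : LRMultiF r α.1 // ∀ k, M.cont k = (ρ k).1} = multCoef ρ α := by
  have := fun lam mu κ : PB n => finite_lrTab lam mu κ
  rw [Nat.card_congr (multEquiv ρ α), Nat.card_sigma]
  unfold multCoef
  refine sum_congr rfl fun c _ => ?_
  rw [Nat.card_pi]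
  rfl

theorem LRMultiF.exists_cont {n r : ℕ} {α : PB n} (M : LRMultiF r α.1) (k : Fin r) :
    ∃ mu : PB n, mu.1 = M.cont k ∧ mu.size = M.size k :=
  IsLR.content (κ := M.chainPB k.succ) (lam := M.chainPB k.castSucc) (M.mono k) (M.lr k)

/-- The content of the `k`-th tableau of a multitableau, as a partition. -/
def LRMultiF.contPB {n r : ℕ} {α : PB n} (M : LRMultiF r α.1) (k : Fin r) : PB n :=
  Classical.choose (M.exists_cont k)

theorem LRMultiF.contPB_val {n r : ℕ} {α : PB n} (M : LRMultiF r α.1) (k : Fin r) :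
    (M.contPB k).1 = M.cont k := (Classical.choose_spec (M.exists_cont k)).1

theorem LRMultiF.size_contPB {n r : ℕ} {α : PB n} (M : LRMultiF r α.1) (k : Fin r) :
    (M.contPB k).size = M.size k := (Classical.choose_spec (M.exists_cont k)).2

theorem LRMultiF.size_of_cont {n r : ℕ} {α : PB n} (M : LRMultiF r α.1) {k : Fin r} {ρ : PB n}
    (h : M.cont k = ρ.1) : M.size k = ρ.size := by
  rw [← M.size_contPB, Subtype.ext ((M.contPB_val k).trans h)]

/-- The pairs of multitableaux with conjugate contents where the first has content `ρ`. -/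
def starFiberEquiv {n r : ℕ} (α β : PB n) (ν : Fin r → ℕ)
    (ρ : {ρ : Fin r → PB n // ∀ k, (ρ k).size = ν k}) :
    {TS : LRPairsStar n r α.1 β.1 ν // TS.1.1.contPB = ρ.1} ≃
      {M : LRMultiF r α.1 // ∀ k, M.cont k = (ρ.1 k).1} ×
        {N : LRMultiF r β.1 // ∀ k, N.cont k = (ρ.1 k).conj.1} where
  toFun TS := (⟨TS.1.1.1, fun k => (LRMultiF.contPB_val _ k).symm.trans
      (congrArg (fun ρ : Fin r → PB n => (ρ k).1) TS.2)⟩,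
    ⟨TS.1.1.2, fun k => funext fun i => (TS.1.2.2.2 k i).trans
      (congrFun (congrArg (conjFun n) ((LRMultiF.contPB_val _ k).symm.trans
        (congrArg (fun ρ : Fin r → PB n => (ρ k).1) TS.2))) i)⟩)
  invFun MN := ⟨⟨(MN.1.1, MN.2.1),
    fun k => (MN.1.1.size_of_cont (MN.1.2 k)).trans (ρ.2 k),
    fun k => (MN.2.1.size_of_cont (MN.2.2 k)).trans ((PB.size_conj _).trans (ρ.2 k)),
    fun k i => by
      dsimp only
      rw [MN.2.2, MN.1.2]
      rfl⟩, funext fun k => Subtype.ext ((LRMultiF.contPB_val _ k).trans (MN.1.2 k))⟩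
  left_inv _ := rfl
  right_inv _ := rfl

/-- The pairs of multitableaux with conjugate contents, split according to the contents. -/
def starEquiv {n r : ℕ} (α β : PB n) (ν : Fin r → ℕ) :
    LRPairsStar n r α.1 β.1 ν ≃ Σ ρ : {ρ : Fin r → PB n // ∀ k, (ρ k).size = ν k},
      {M : LRMultiF r α.1 // ∀ k, M.cont k = (ρ.1 k).1} ×
        {N : LRMultiF r β.1 // ∀ k, N.cont k = (ρ.1 k).conj.1} :=
  (Equiv.sigmaFiberEquiv fun TS : LRPairsStar n r α.1 β.1 ν =>
      (⟨TS.1.1.contPB, fun k => (TS.1.1.size_contPB k).trans (TS.2.1 k)⟩ :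
        {ρ : Fin r → PB n // ∀ k, (ρ k).size = ν k})).symm.trans
    (Equiv.sigmaCongrRight fun ρ =>
      (Equiv.subtypeEquivRight fun _ => Subtype.ext_iff).trans (starFiberEquiv α β ν ρ))

theorem finite_star {n r : ℕ} (α β : PB n) (ν : Fin r → ℕ) :
    Finite (LRPairsStar n r α.1 β.1 ν) := by
  have := fun (ρ : Fin r → PB n) (α : PB n) => finite_mult ρ α
  have := fun (ρ : Fin r → PB n) (α : PB n) => finite_mult (fun k => (ρ k).conj) α
  exact Finite.of_equiv _ (starEquiv α β ν).symm

theorem card_star {n r : ℕ} (α β : PB n) (ν : Fin r → ℕ) :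
    Nat.card (LRPairsStar n r α.1 β.1 ν) =
      ∑ ρ : {ρ : Fin r → PB n // ∀ k, (ρ k).size = ν k},
        multCoef ρ.1 α * multCoef (fun k => (ρ.1 k).conj) β := by
  have := fun (ρ : Fin r → PB n) (α : PB n) => finite_mult ρ α
  have := fun (ρ : Fin r → PB n) (α : PB n) => finite_mult (fun k => (ρ k).conj) α
  rw [Nat.card_congr (starEquiv α β ν), Nat.card_sigma]
  refine sum_congr rfl fun ρ _ => ?_
  rw [Nat.card_prod, card_mult, ← card_mult (fun k => (ρ.1 k).conj)]

theorem prod_binGen_eq_sum {R : Type*} [CommRing R] {n p q r : ℕ} (x : Fin p → R) (y : Fin q → R)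
    (ν : Fin r → ℕ) (hν : ∑ k, ν k = n) : ∏ k, binGen x y (ν k) =
      ∑ α : PB n, ∑ β : PB n, (Nat.card (LRPairsStar n r α.1 β.1 ν) : R) *
        (schur x α.1 * schur y β.1) := by
  have hk : ∀ k, ν k ≤ n := fun k => by
    rw [← hν]
    exact single_le_sum (fun _ _ => Nat.zero_le _) (mem_univ k)
  rw [prod_congr rfl fun k _ => binGen_eq_sum_schur (hk k) x y, prod_univ_sum,
    Fintype.piFinset_univ]
  have h1 : ∀ ρ : Fin r → PB n, (∏ k, if (ρ k).size = ν k then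
      schur x (ρ k).1 * schur y (ρ k).conj.1 else 0) = if ∀ k, (ρ k).size = ν k then
        ∑ α : PB n, ∑ β : PB n, ((multCoef ρ α * multCoef (fun k => (ρ k).conj) β : ℕ) : R) *
          (schur x α.1 * schur y β.1) else 0 := by
    intro ρ
    split_ifs with h
    · rw [prod_congr rfl fun k _ => if_pos (h k), prod_mul_distrib, prod_schur_eq x ρ,
        prod_schur_eq y fun k => (ρ k).conj, sum_mul_sum]
      · refine sum_congr rfl fun α _ => sum_congr rfl fun β _ => ?_
        push_cast
        ring
      · simp only [PB.size_conj, h, hν, le_refl]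
      · simp only [h, hν, le_refl]
    · push Not at h
      obtain ⟨k, hk⟩ := h
      exact prod_eq_zero (mem_univ k) (if_neg hk)
  rw [sum_congr rfl fun ρ _ => h1 ρ, ← sum_filter, sum_comm]
  refine sum_congr rfl fun α _ => ?_
  rw [sum_comm]
  refine sum_congr rfl fun β _ => ?_
  rw [← sum_mul, card_star, Nat.cast_sum]
  congr 1
  exact sum_subtype _ (by simp) fun ρ : Fin r → PB n =>
    ((multCoef ρ α * multCoef (fun k => (ρ k).conj) β : ℕ) : R)

theorem coeff_prod_X_pow {σ : Type*} [Fintype σ] (f g : σ → ℕ) :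
    MvPolynomial.coeff (Finsupp.equivFunOnFinite.symm g)
      (∏ s, (MvPolynomial.X s : MvPolynomial σ ℤ) ^ f s) = if f = g then 1 else 0 := by
  have h : ∏ s, (MvPolynomial.X s : MvPolynomial σ ℤ) ^ f s
      = MvPolynomial.monomial (Finsupp.equivFunOnFinite.symm f) 1 := by
    rw [MvPolynomial.monomial_eq, Finsupp.prod_fintype _ _ (by simp)]
    simp
  rw [h, MvPolynomial.coeff_monomial]
  congr 1
  exact propext Finsupp.equivFunOnFinite.symm.injective.eq_iff

/-- The number of patterns of given top row and weight. -/
def gtCount {p : ℕ} (a : ℕ → ℕ) (l : Fin p → ℕ) : ℕ :=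
  Nat.card {g : ℕ → ℕ → ℕ // IsGT p a g ∧ ∀ k : Fin p, gtWeight p g k = l k}

theorem gtCount_eq {p : ℕ} (a : ℕ → ℕ) (l : Fin p → ℕ) :
    (gtCount a l : ℤ) = ∑ g : {g : ℕ → ℕ → ℕ // IsGT p a g},
      if (fun k : Fin p => gtWeight p g.1 k) = l then 1 else 0 := by
  rw [sum_boole, ← Fintype.card_subtype, ← Nat.card_eq_fintype_card, gtCount]
  congr 1
  refine Nat.card_congr ((Equiv.subtypeSubtypeEquivSubtypeInter _ _).symm.trans
    (Equiv.subtypeEquivRight fun g => funext_iff.symm))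

theorem coeff_schur_mul_schur {p q : ℕ} (a b : ℕ → ℕ) (l : Fin p → ℕ) (m : Fin q → ℕ) :
    MvPolynomial.coeff (Finsupp.equivFunOnFinite.symm (Sum.elim l m))
      (schur (fun i => (MvPolynomial.X (Sum.inl i) : MvPolynomial (Fin p ⊕ Fin q) ℤ)) a *
        schur (fun j => (MvPolynomial.X (Sum.inr j) : MvPolynomial (Fin p ⊕ Fin q) ℤ)) b) = gtCount a l * gtCount b m := by
  rw [gtCount_eq, gtCount_eq]
  unfold schur
  rw [sum_mul_sum, sum_mul_sum, MvPolynomial.coeff_sum]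
  refine sum_congr rfl fun g _ => ?_
  rw [MvPolynomial.coeff_sum]
  refine sum_congr rfl fun h _ => ?_
  have := coeff_prod_X_pow (Sum.elim (fun k : Fin p => gtWeight p g.1 k)
    fun k : Fin q => gtWeight q h.1 k) (Sum.elim l m)
  rw [Fintype.prod_sum_type] at this
  simp only [Sum.elim_inl, Sum.elim_inr] at this
  rw [this, ite_zero_mul_ite_zero, one_mul]
  congr 1
  exact propext Sum.elim_eq_iff

/-- Three-dimensional binary matrices with given marginals, as sequences of their layers. -/
abbrev LayerMat {p q r : ℕ} (l : Fin p → ℕ) (m : Fin q → ℕ) (ν : Fin r → ℕ) : Type :=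
  {A : ∀ k : Fin r, {A : Fin q → Fin p → Fin 2 // ∑ j, ∑ i, (A j i : ℕ) = ν k} //
    (∀ i, ∑ k, ∑ j, ((A k).1 j i : ℕ) = l i) ∧ ∀ j, ∑ k, ∑ i, ((A k).1 j i : ℕ) = m j}

theorem coeff_prod_binGen {p q r : ℕ} (l : Fin p → ℕ) (m : Fin q → ℕ) (ν : Fin r → ℕ) :
    MvPolynomial.coeff (Finsupp.equivFunOnFinite.symm (Sum.elim l m))
      (∏ k, binGen (fun i => (MvPolynomial.X (Sum.inl i) : MvPolynomial (Fin p ⊕ Fin q) ℤ))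
        (fun j => MvPolynomial.X (Sum.inr j)) (ν k)) = Nat.card (LayerMat l m ν) := by
  unfold binGen
  rw [prod_univ_sum, Fintype.piFinset_univ, MvPolynomial.coeff_sum, Nat.card_eq_fintype_card,
    Fintype.card_subtype, ← sum_boole]
  refine sum_congr rfl fun A _ => ?_
  have := coeff_prod_X_pow (Sum.elim (fun i => ∑ k, ∑ j, ((A k).1 j i : ℕ))
    fun j => ∑ k, ∑ i, ((A k).1 j i : ℕ)) (Sum.elim l m)
  rw [Fintype.prod_sum_type] at this
  simp only [Sum.elim_inl, Sum.elim_inr] at this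
  refine Eq.trans (congrArg _ ?_) (this.trans ?_)
  · simp only [mul_pow, prod_mul_distrib, ← prod_pow_eq_pow_sum]
    congr 1
    · exact (prod_congr rfl fun k _ => prod_comm).trans prod_comm
    · exact prod_comm
  · congr 1
    rw [Sum.elim_eq_iff, funext_iff, funext_iff]

theorem card_layerMat {n p q r : ℕ} (l : Fin p → ℕ) (m : Fin q → ℕ) (ν : Fin r → ℕ)
    (hν : ∑ k, ν k = n) : Nat.card (LayerMat l m ν) = ∑ α : PB n, ∑ β : PB n,
      Nat.card (LRPairsStar n r α.1 β.1 ν) * (gtCount α.1 l * gtCount β.1 m) := by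
  have h := congrArg (MvPolynomial.coeff (Finsupp.equivFunOnFinite.symm (Sum.elim l m)))
    (prod_binGen_eq_sum (fun i => (MvPolynomial.X (Sum.inl i) : MvPolynomial (Fin p ⊕ Fin q) ℤ))
      (fun j => MvPolynomial.X (Sum.inr j)) ν hν)
  rw [coeff_prod_binGen, MvPolynomial.coeff_sum] at h
  zify
  rw [h]
  refine sum_congr rfl fun α _ => ?_
  rw [MvPolynomial.coeff_sum]
  refine sum_congr rfl fun β _ => ?_
  rw [← map_natCast MvPolynomial.C, MvPolynomial.coeff_C_mul, coeff_schur_mul_schur]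

/-- The layers of a three-dimensional binary matrix. -/
def layerEquiv {p q r : ℕ} (l : Fin p → ℕ) (m : Fin q → ℕ) (ν : Fin r → ℕ) :
    {A : Fin p → Fin q → Fin r → ℕ // (∀ i j k, A i j k ≤ 1) ∧
      (∀ i, ∑ j, ∑ k, A i j k = l i) ∧ (∀ j, ∑ i, ∑ k, A i j k = m j) ∧
      (∀ k, ∑ i, ∑ j, A i j k = ν k)} ≃ LayerMat l m ν where
  toFun A := ⟨fun k => ⟨fun j i => ⟨A.1 i j k, Nat.lt_succ_of_le (A.2.1 i j k)⟩,
      sum_comm.trans (A.2.2.2.2 k)⟩,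
    fun i => sum_comm.trans (A.2.2.1 i), fun j => sum_comm.trans (A.2.2.2.1 j)⟩
  invFun A := ⟨fun i j k => ((A.1 k).1 j i : ℕ), fun i j k => Nat.le_of_lt_succ ((A.1 k).1 j i).2,
    fun i => sum_comm.trans (A.2.1 i), fun j => sum_comm.trans (A.2.2 j),
    fun k => sum_comm.trans (A.1 k).2⟩
  left_inv _ := rfl
  right_inv _ := rfl

theorem antitone_getD {L : List ℕ} (hL : L.Pairwise (· ≥ ·)) : Antitone fun i => L.getD i 0 := by
  induction L with
  | nil => intro i j _; simp
  | cons x L ih =>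
    rw [List.pairwise_cons] at hL
    refine antitone_nat_of_succ_le fun i => ?_
    cases i with
    | zero =>
      simp only [List.getD_cons_succ, List.getD_cons_zero]
      rcases lt_or_ge 0 L.length with h | h
      · rw [List.getD_eq_getElem _ _ h]
        exact hL.1 _ (List.getElem_mem h)
      · rw [List.getD_eq_default _ _ h]
        exact Nat.zero_le _
    | succ i => exact ih hL.2 (Nat.le_succ i)

theorem map_getD_range {L : List ℕ} {N : ℕ} (h : L.length ≤ N) (h0 : 0 ∉ L) :
    ((Multiset.range N).map fun i => L.getD i 0).filter (· ≠ 0) = L := by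
  have h1 : (List.range N).map (fun i => L.getD i 0) = L ++ List.replicate (N - L.length) 0 := by
    refine List.ext_getElem (by simp; omega) fun i hi _ => ?_
    simp only [List.getElem_map, List.getElem_range, List.getElem_append, List.getElem_replicate]
    split_ifs with h2
    · rw [List.getD_eq_getElem _ _ h2]
    · rw [List.getD_eq_default _ _ (not_lt.1 h2)]
  rw [← Multiset.coe_range, Multiset.map_coe, h1, Multiset.filter_coe, List.filter_append,
    List.filter_eq_self.2, List.filter_eq_nil_iff.2, List.append_nil]
  · intro a ha
    simp [List.eq_of_mem_replicate ha]
  · intro a ha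
    have : a ≠ 0 := fun h => h0 (by rwa [h] at ha)
    simpa using this

/-- The multiset of nonzero entries among the first `n`. -/
def partsOf (n : ℕ) (a : ℕ → ℕ) : Multiset ℕ := ((Multiset.range n).map a).filter (· ≠ 0)

theorem sum_partsOf (n : ℕ) (a : ℕ → ℕ) : (partsOf n a).sum = ∑ i ∈ range n, a i := by
  have h := Multiset.filter_add_not (· ≠ 0) ((Multiset.range n).map a)
  have h1 : (((Multiset.range n).map a).filter fun x => ¬x ≠ 0).sum = 0 :=
    Multiset.sum_eq_zero fun x hx => not_not.1 (Multiset.mem_filter.1 hx).2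
  have h2 := congrArg Multiset.sum h
  rw [Multiset.sum_add, h1, add_zero] at h2
  exact h2

theorem partsOf_pf {n : ℕ} (P : n.Partition) : partsOf n (pf P) = P.parts := by
  have h0 : (0 : ℕ) ∉ P.parts := fun h => (P.parts_pos h).ne rfl
  have h1 : P.parts.card ≤ n := by
    have := Multiset.card_nsmul_le_sum (s := P.parts) (a := 1) fun x hx => P.parts_pos hx
    rw [P.parts_sum] at this
    simpa using this
  unfold partsOf pf
  rw [map_getD_range]
  · rw [Multiset.coe_reverse, Multiset.sort_eq]
  · simpa using h1
  · simpa using h0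

theorem antitone_pf {n : ℕ} (P : n.Partition) : Antitone (pf P) :=
  antitone_getD (List.pairwise_reverse.2 (P.parts.pairwise_sort (· ≤ ·)))

/-- A partition as a bounded partition. -/
def pfPB {n : ℕ} (P : n.Partition) : PB n :=
  ⟨pf P, antitone_pf P, fun i hi => by
    have h := Multiset.card_nsmul_le_sum (s := P.parts) (a := 1) fun x hx => P.parts_pos hx
    rw [P.parts_sum] at h
    refine List.getD_eq_default _ _ ?_
    simp at h ⊢
    omega, by rw [← sum_partsOf, partsOf_pf, P.parts_sum]⟩

theorem pfPB_injective (n : ℕ) : Function.Injective (pfPB : n.Partition → PB n) := by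
  intro P Q h
  refine Nat.Partition.ext ?_
  rw [← partsOf_pf, ← partsOf_pf Q]
  exact congrArg (partsOf n) (congrArg Subtype.val h)

theorem conjFun_eq_card_partsOf (n : ℕ) (a : ℕ → ℕ) (j : ℕ) :
    conjFun n a j = ((partsOf n a).filter (j < ·)).card := by
  unfold conjFun partsOf
  rw [Multiset.filter_filter, Multiset.filter_map, Multiset.card_map]
  change Multiset.card (Multiset.filter _ (Multiset.range n)) = _
  congr 1
  refine Multiset.filter_congr fun i _ => ?_
  simp only [Function.comp]
  omega

theorem PB.ext_of_partsOf {n : ℕ} {a b : PB n} (h : partsOf n a.1 = partsOf n b.1) : a = b := by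
  have : a.conj = b.conj := Subtype.ext (funext fun j => by
    change conjFun n a.1 j = conjFun n b.1 j
    rw [conjFun_eq_card_partsOf, h, ← conjFun_eq_card_partsOf])
  rw [← a.conj_conj, this, b.conj_conj]

theorem exists_pfPB {n : ℕ} (a : PB n) (ha : a.size = n) : ∃ P : n.Partition, pfPB P = a := by
  let P : n.Partition := ⟨partsOf n a.1, fun h => Nat.pos_of_ne_zero (Multiset.mem_filter.1 h).2,
    by rw [sum_partsOf]; exact ha⟩
  exact ⟨P, PB.ext_of_partsOf (partsOf_pf P)⟩

theorem size_of_gtCount_ne_zero {n p : ℕ} {a : PB n} {l : Fin p → ℕ} (hl : ∑ i, l i = n)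
    (h : gtCount a.1 l ≠ 0) : a.size = n := by
  obtain ⟨g, hg, hw⟩ := (Nat.card_ne_zero.1 h).1
  rw [a.size_eq fun i hi => hg.top_eq_zero hi, ← sum_gtWeight hg, ← Fin.sum_univ_eq_sum_range, ← hl]
  exact sum_congr rfl fun k _ => hw k

theorem dominates_of_gtCount_ne_zero {p : ℕ} {a : ℕ → ℕ} {l : Fin p → ℕ}
    (h : gtCount a l ≠ 0) : Dominates a (extc l) := by
  obtain ⟨g, hg, hw⟩ := (Nat.card_ne_zero.1 h).1
  have hl : extc l = gtWeight p g := by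
    funext k
    rcases lt_or_ge k p with hk | hk
    · rw [extc_of_lt l ⟨k, hk⟩, ← hw]
    · rw [extc_of_ge l hk, hg.weight_eq_zero hk]
  have hs : ∀ k, ∑ j ∈ range k, gtWeight p g j = gtSum g k p := by
    intro k
    induction k with
    | zero => simp [hg.gtSum_zero_level]
    | succ k ih => rw [sum_range_succ, ih, hg.weight_add]
  intro k
  rw [hl, hs]
  calc gtSum g k p ≤ gtSum g k (max k p) := sum_le_sum_of_subset (range_mono (le_max_right _ _))
    _ = gtSum g k k := hg.gtSum_stable le_rfl (le_max_left _ _)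
    _ ≤ _ := sum_le_sum fun i _ => hg.le_top k i

/-- Semistandard tableaux of given shape and content. -/
abbrev SSYTab {p : ℕ} (a : ℕ → ℕ) (l : Fin p → ℕ) : Type :=
  {T : ℕ → ℕ → ℕ // IsSSYT a T ∧ ∀ k, skewContent a (fun _ => 0) T k = extc l k}

theorem finite_ssyTab {n p : ℕ} (a : PB n) (l : Fin p → ℕ) : Finite (SSYTab a.1 l) := by
  obtain ⟨e⟩ := nonempty_ssyt_equiv a.2.1 a.2.2.1 l
  have := Finite.of_injective (fun g : {g // IsGT p a.1 g ∧ ∀ k : Fin p, gtWeight p g k = l k} =>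
    (⟨g.1, g.2.1⟩ : {g // IsGT p a.1 g})) fun g h e => Subtype.ext (by simpa using e)
  exact Finite.of_equiv _ e.symm

theorem card_ssyTab {n p : ℕ} (a : PB n) (l : Fin p → ℕ) :
    Nat.card (SSYTab a.1 l) = gtCount a.1 l := by
  obtain ⟨e⟩ := nonempty_ssyt_equiv a.2.1 a.2.2.1 l
  exact Nat.card_congr e

theorem card_layerMat_eq_sum {n p q r : ℕ} (l : Fin p → ℕ) (m : Fin q → ℕ) (ν : Fin r → ℕ)
    (hl : ∑ i, l i = n) (hm : ∑ j, m j = n) (hν : ∑ k, ν k = n) :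
    Nat.card (LayerMat l m ν) = ∑ ab : {ab : n.Partition × n.Partition //
        Dominates (pf ab.1) (extc l) ∧ Dominates (pf ab.2) (extc m)},
      Nat.card (LRPairsStar n r (pf ab.1.1) (pf ab.1.2) ν) *
        (gtCount (pf ab.1.1) l * gtCount (pf ab.1.2) m) := by
  rw [card_layerMat l m ν hν]
  let F : PB n × PB n → ℕ := fun x => Nat.card (LRPairsStar n r x.1.1 x.2.1 ν) *
    (gtCount x.1.1 l * gtCount x.2.1 m)
  refine (Fintype.sum_prod_type F).symm.trans ?_
  let E : {ab : n.Partition × n.Partition //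
      Dominates (pf ab.1) (extc l) ∧ Dominates (pf ab.2) (extc m)} → PB n × PB n :=
    fun ab => (pfPB ab.1.1, pfPB ab.1.2)
  refine (Fintype.sum_of_injective E ?_ (fun ab => F (E ab)) F ?_ fun _ => rfl).symm
  · intro ab cd h
    exact Subtype.ext (Prod.ext (pfPB_injective n (congrArg Prod.fst h))
      (pfPB_injective n (congrArg Prod.snd h)))
  · rintro ⟨α, β⟩ h
    by_contra hc
    have h1 : gtCount α.1 l ≠ 0 := fun h0 => hc (by simp [F, h0])
    have h2 : gtCount β.1 m ≠ 0 := fun h0 => hc (by simp [F, h0])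
    obtain ⟨P, rfl⟩ := exists_pfPB α (size_of_gtCount_ne_zero hl h1)
    obtain ⟨Q, rfl⟩ := exists_pfPB β (size_of_gtCount_ne_zero hm h2)
    exact h ⟨⟨(P, Q), dominates_of_gtCount_ne_zero h1, dominates_of_gtCount_ne_zero h2⟩, rfl⟩

end

/-- bijection between `M*(l,m,ν)` and
`⨿_{α ⊵ l, β ⊵ m} SSYT(α,l) × SSYT(β,m) × LR*(α,β;ν)`. -/
theorem stmt17 (n p q r : ℕ) (l : Fin p → ℕ) (m : Fin q → ℕ) (ν : Fin r → ℕ)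
    (hl : ∑ i, l i = n) (hm : ∑ j, m j = n) (hν : ∑ k, ν k = n) :
    Nonempty
      ({A : Fin p → Fin q → Fin r → ℕ // (∀ i j k, A i j k ≤ 1) ∧
          (∀ i, ∑ j, ∑ k, A i j k = l i) ∧ (∀ j, ∑ i, ∑ k, A i j k = m j) ∧
          (∀ k, ∑ i, ∑ j, A i j k = ν k)} ≃
        Σ ab : {ab : n.Partition × n.Partition //
            Dominates (pf ab.1) (extc l) ∧ Dominates (pf ab.2) (extc m)},
          {T : ℕ → ℕ → ℕ //
              IsSSYT (pf ab.1.1) T ∧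
              ∀ k, skewContent (pf ab.1.1) (fun _ => 0) T k = extc l k} ×
          {T : ℕ → ℕ → ℕ //
              IsSSYT (pf ab.1.2) T ∧
              ∀ k, skewContent (pf ab.1.2) (fun _ => 0) T k = extc m k} ×
          LRPairsStar n r (pf ab.1.1) (pf ab.1.2) ν) := by
  refine ⟨(layerEquiv l m ν).trans (Classical.choice ?_)⟩
  have h1 : ∀ (P : n.Partition) {s : ℕ} (c : Fin s → ℕ), Finite (SSYTab (pf P) c) :=
    fun P _ c => finite_ssyTab (pfPB P) c
  have h2 : ∀ P Q : n.Partition, Finite (LRPairsStar n r (pf P) (pf Q) ν) :=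
    fun P Q => finite_star (pfPB P) (pfPB Q) ν
  have h3 : ∀ (P : n.Partition) {s : ℕ} (c : Fin s → ℕ),
      Nat.card (SSYTab (pf P) c) = gtCount (pf P) c := fun P _ c => card_ssyTab (pfPB P) c
  refine Finite.card_eq.1 ?_
  rw [card_layerMat_eq_sum l m ν hl hm hν, Nat.card_sigma]
  refine sum_congr rfl fun ab _ => ?_
  rw [Nat.card_prod, Nat.card_prod, h3, h3]
  ring
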